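/- arXiv:1702.01734 — 6 statements merged into one kernel-verified Lean document; each statement's English description precedes it below -/
import Mathlib

section
/- Let F be a field and let α_1, …, α_n be independent indeterminates. Let P_1, …, P_5 ∈ (F[α_1,…,α_n])[α] be polynomials of the form P_i(α) = ∏_{γ ∈ N_i} (α − γ) with N_i ⊆ {α_1,…,α_n}, each of degree d_i = 4 (so m = 5). If W(P_1,…,P_5) ≡ 0, then {P_1,…,P_5} has the generalized rectangular property (GRP). -/
open Polynomial

/-- The polynomial `P(α) = ∏_{γ ∈ Ni} (α - γ)`, where the roots are the
indeterminates `α_j` for `j ∈ Ni`, viewed as a univariate polynomial over the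
multivariate polynomial ring `F[α_1, …, α_n]`. -/
noncomputable def rootPoly (F : Type*) [Field F] {n : ℕ} (Ni : Finset (Fin n)) :
    Polynomial (MvPolynomial (Fin n) F) :=
  ∏ γ ∈ Ni, (Polynomial.X - Polynomial.C (MvPolynomial.X γ))

/-- `W(P_1, …, P_m) = det((C_{j,i})_{i,j ∈ [m]})`, where
`P_i(α) = Σ_{j=1}^m C_{i,j} α^{j-1}`. -/
noncomputable def Wdet (F : Type*) [Field F] {n m : ℕ}
    (N : Fin m → Finset (Fin n)) : MvPolynomial (Fin n) F :=
  Matrix.det (Matrix.of fun i j : Fin m => (rootPoly F (N j)).coeff (i : ℕ))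

/-- Generalized rectangular property: for some `1 < k ≤ m` and `0 ≤ l ≤ m - k`,
there exist at least `k` polynomials of degree at most `m - l - 1` having at
least `m - k - l + 1` common roots. -/
def GRP {n m : ℕ} (N : Fin m → Finset (Fin n)) : Prop :=
  ∃ k l : ℕ, 1 < k ∧ k ≤ m ∧ l ≤ m - k ∧
    ∃ I : Finset (Fin m), k ≤ I.card ∧
      (∀ i ∈ I, (N i).card ≤ m - l - 1) ∧
      ∃ S : Finset (Fin n), m - k - l + 1 ≤ S.card ∧ ∀ i ∈ I, S ⊆ N i

/-- The polynomial `X ^ t * ∏_{γ ∈ S} (X - α_γ)`, whose roots are the indeterminates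
indexed by `S` and `0` with multiplicity `t`. -/
noncomputable def zeroRootPoly (F : Type*) [Field F] {n : ℕ} (S : Finset (Fin n)) (t : ℕ) :
    Polynomial (MvPolynomial (Fin n) F) :=
  X ^ t * rootPoly F S

/-- The multiplicity form of the generalized non-rectangular property: the `i`-th polynomial has
`S i` and `t i` zeros as roots and may be multiplied by polynomials of degree less than `c i`
without reaching degree `k`; common roots of any subfamily leave enough room for all multiples. -/
structure RootBound {ι : Type*} {n : ℕ} (k : ℕ) (I : Finset ι) (S : ι → Finset (Fin n))
    (t c : ι → ℕ) : Prop where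
  degree_add : ∀ i ∈ I, c i + (S i).card + t i = k
  bound : ∀ J ⊆ I, J.Nonempty → ∀ (T : Finset (Fin n)) (u : ℕ),
    (∀ i ∈ J, T ⊆ S i ∧ u ≤ t i) → ∑ i ∈ J, c i + T.card + u ≤ k

/-- The multiples of the polynomials `zeroRootPoly F (S i) (t i)` by polynomials of degree less
than `c i` are independent. -/
def MultiplesIndep (F : Type*) [Field F] {ι : Type*} {n : ℕ} (I : Finset ι)
    (S : ι → Finset (Fin n)) (t c : ι → ℕ) : Prop :=
  ∀ h : ι → Polynomial (MvPolynomial (Fin n) F), (∀ i ∈ I, (h i).degree < c i) →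
    ∑ i ∈ I, h i * zeroRootPoly F (S i) (t i) = 0 → ∀ i ∈ I, h i = 0

section

variable {F : Type*} [Field F] {n : ℕ}

theorem rootPoly_monic (S : Finset (Fin n)) : (rootPoly F S).Monic :=
  monic_prod_of_monic _ _ fun _ _ => monic_X_sub_C _

theorem natDegree_rootPoly (S : Finset (Fin n)) : (rootPoly F S).natDegree = S.card := by
  rw [rootPoly, natDegree_prod_of_monic _ _ fun _ _ => monic_X_sub_C _]
  simp

theorem zeroRootPoly_monic (S : Finset (Fin n)) (t : ℕ) : (zeroRootPoly F S t).Monic :=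
  (monic_X_pow t).mul (rootPoly_monic S)

theorem degree_zeroRootPoly (S : Finset (Fin n)) (t : ℕ) :
    (zeroRootPoly F S t).degree = ((S.card + t : ℕ) : WithBot ℕ) := by
  rw [degree_eq_natDegree (zeroRootPoly_monic S t).ne_zero, zeroRootPoly,
    (monic_X_pow t).natDegree_mul (rootPoly_monic S), natDegree_X_pow, natDegree_rootPoly,
    add_comm]

theorem zeroRootPoly_add_one (S : Finset (Fin n)) (t : ℕ) :
    zeroRootPoly F S (t + 1) = X * zeroRootPoly F S t := by
  rw [zeroRootPoly, zeroRootPoly, pow_succ']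
  ring

theorem zeroRootPoly_mul_sdiff {S T : Finset (Fin n)} {t u : ℕ} (hT : T ⊆ S) (hu : u ≤ t) :
    zeroRootPoly F T u * zeroRootPoly F (S \ T) (t - u) = zeroRootPoly F S t := by
  have h : rootPoly F (S \ T) * rootPoly F T = rootPoly F S := Finset.prod_sdiff hT
  have h' : (X : Polynomial (MvPolynomial (Fin n) F)) ^ u * X ^ (t - u) = X ^ t := by
    rw [← pow_add, Nat.add_sub_cancel' hu]
  simp only [zeroRootPoly]
  rw [← h, ← h']
  ring

theorem coeff_zero_rootPoly_ne_zero (S : Finset (Fin n)) : (rootPoly F S).coeff 0 ≠ 0 := by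
  rw [coeff_zero_eq_eval_zero, rootPoly, eval_prod, Finset.prod_ne_zero_iff]
  intro a _
  simp [MvPolynomial.X_ne_zero]

/-- The substitution `α_a = 0`. -/
noncomputable def killVar (F : Type*) [Field F] {n : ℕ} (a : Fin n) :
    MvPolynomial (Fin n) F →+* MvPolynomial (Fin n) F :=
  (MvPolynomial.aeval (R := F) fun j => if j = a then 0 else MvPolynomial.X j).toRingHom

theorem X_dvd_of_killVar_eq_zero {a : Fin n} {p : MvPolynomial (Fin n) F}
    (hp : killVar F a p = 0) : MvPolynomial.X a ∣ p := by
  suffices h : MvPolynomial.X a ∣ p - killVar F a p by simpa [hp] using h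
  clear hp
  induction p using MvPolynomial.induction_on with
  | C r => simp [killVar]
  | add p q hp hq =>
    rw [map_add, add_sub_add_comm]
    exact dvd_add hp hq
  | mul_X p j hp =>
    have hj : MvPolynomial.X a ∣ MvPolynomial.X j - killVar F a (MvPolynomial.X j) := by
      by_cases h : j = a <;> simp [killVar, h]
    have e : p * MvPolynomial.X j - killVar F a (p * MvPolynomial.X j) =
        (p - killVar F a p) * MvPolynomial.X j +
          killVar F a p * (MvPolynomial.X j - killVar F a (MvPolynomial.X j)) := by
      rw [map_mul]
      ring
    rw [e]
    exact dvd_add (hp.mul_right _) (hj.mul_left _)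

theorem C_X_dvd_of_map_killVar_eq_zero {a : Fin n} {p : Polynomial (MvPolynomial (Fin n) F)}
    (hp : p.map (killVar F a) = 0) : C (MvPolynomial.X a) ∣ p := by
  rw [C_dvd_iff_dvd_coeff]
  intro i
  apply X_dvd_of_killVar_eq_zero
  rw [← coeff_map, hp, coeff_zero]

theorem map_killVar_zeroRootPoly (a : Fin n) (S : Finset (Fin n)) (t : ℕ) :
    (zeroRootPoly F S t).map (killVar F a) =
      zeroRootPoly F (S.erase a) (t + if a ∈ S then 1 else 0) := by
  have h : ∀ T : Finset (Fin n), a ∉ T → (rootPoly F T).map (killVar F a) = rootPoly F T := by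
    intro T hT
    rw [rootPoly, Polynomial.map_prod]
    refine Finset.prod_congr rfl fun j hj => ?_
    have : j ≠ a := fun e => hT (e ▸ hj)
    simp [killVar, this]
  by_cases ha : a ∈ S
  · have e : rootPoly F S = (X - C (MvPolynomial.X a)) * rootPoly F (S.erase a) :=
      (Finset.mul_prod_erase S _ ha).symm
    rw [zeroRootPoly, e, Polynomial.map_mul, Polynomial.map_mul, h _ (Finset.notMem_erase a S)]
    simp only [zeroRootPoly, killVar, Polynomial.map_pow, map_X, Polynomial.map_sub, map_C, ha,
      if_true]
    simp
    ring
  · rw [zeroRootPoly, Polynomial.map_mul, h _ ha, Finset.erase_eq_of_notMem ha]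
    simp [zeroRootPoly, ha]

theorem eq_zero_of_forall_C_X_pow_dvd {a : Fin n} {p : Polynomial (MvPolynomial (Fin n) F)}
    (hp : ∀ e : ℕ, C (MvPolynomial.X a) ^ e ∣ p) : p = 0 := by
  ext1 i
  rw [coeff_zero]
  by_contra hne
  have hd : (MvPolynomial.X a : MvPolynomial (Fin n) F) ^ ((p.coeff i).totalDegree + 1) ∣
      p.coeff i := by
    have := hp ((p.coeff i).totalDegree + 1)
    rw [← C_pow, C_dvd_iff_dvd_coeff] at this
    exact this i
  obtain ⟨q, hq⟩ := hd
  have hq0 : q ≠ 0 := by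
    rintro rfl
    exact hne (by rw [hq, mul_zero])
  have := MvPolynomial.totalDegree_mul_of_isDomain
    (pow_ne_zero ((p.coeff i).totalDegree + 1) (MvPolynomial.X_ne_zero (R := F) a)) hq0
  rw [← hq, MvPolynomial.totalDegree_X_pow] at this
  omega

variable {ι : Type*} {k : ℕ} {I : Finset ι} {S : ι → Finset (Fin n)} {t c : ι → ℕ}

theorem RootBound.mono (hB : RootBound k I S t c) {J : Finset ι} (hJ : J ⊆ I) :
    RootBound k J S t c :=
  ⟨fun i hi => hB.degree_add i (hJ hi), fun L hL => hB.bound L (hL.trans hJ)⟩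

theorem MultiplesIndep.of_killVar (a : Fin n)
    (hI : MultiplesIndep F I (fun i => (S i).erase a)
      (fun i => t i + if a ∈ S i then 1 else 0) c) : MultiplesIndep F I S t c := by
  have hX : (C (MvPolynomial.X a) : Polynomial (MvPolynomial (Fin n) F)) ≠ 0 :=
    C_ne_zero.2 (MvPolynomial.X_ne_zero a)
  have key : ∀ (e : ℕ) (h : ι → Polynomial (MvPolynomial (Fin n) F)),
      (∀ i ∈ I, (h i).degree < c i) → ∑ i ∈ I, h i * zeroRootPoly F (S i) (t i) = 0 →
      ∀ i ∈ I, C (MvPolynomial.X a) ^ e ∣ h i := by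
    intro e
    induction e with
    | zero => simp
    | succ e ih =>
      intro h hdeg hsum
      have hmap : ∀ i ∈ I, (h i).map (killVar F a) = 0 := by
        refine hI (fun i => (h i).map (killVar F a))
          (fun i hi => degree_map_le.trans_lt (hdeg i hi)) ?_
        have := congrArg (Polynomial.map (killVar F a)) hsum
        simpa only [Polynomial.map_sum, Polynomial.map_mul, map_killVar_zeroRootPoly,
          Polynomial.map_zero] using this
      have hdvd : ∀ i, ∃ g, i ∈ I → h i = C (MvPolynomial.X a) * g := by
        intro i
        by_cases hi : i ∈ I
        · obtain ⟨g, hg⟩ := C_X_dvd_of_map_killVar_eq_zero (hmap i hi)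
          exact ⟨g, fun _ => hg⟩
        · exact ⟨0, fun h => absurd h hi⟩
      choose g hg using hdvd
      have hgdvd := ih g (fun i hi => by
        have := hdeg i hi
        rwa [hg i hi, degree_C_mul (MvPolynomial.X_ne_zero a)] at this) (by
        apply mul_left_cancel₀ hX
        rw [mul_zero, Finset.mul_sum, ← hsum]
        refine Finset.sum_congr rfl fun i hi => ?_
        rw [hg i hi, mul_assoc])
      intro i hi
      rw [hg i hi, pow_succ']
      exact mul_dvd_mul_left _ (hgdvd i hi)
  exact fun h hdeg hsum i hi => eq_zero_of_forall_C_X_pow_dvd fun e => key e h hdeg hsum i hi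

theorem MultiplesIndep.of_erase [DecidableEq ι] {j : ι} (hj : c j = 0)
    (hI : MultiplesIndep F (I.erase j) S t c) : MultiplesIndep F I S t c := by
  intro h hdeg hsum
  by_cases hjI : j ∈ I
  · have h0 : h j = 0 := by
      have := hdeg j hjI
      simpa [hj] using this
    rw [← Finset.add_sum_erase _ _ hjI, h0, zero_mul, zero_add] at hsum
    have := hI h (fun i hi => hdeg i (Finset.mem_of_mem_erase hi)) hsum
    intro i hi
    by_cases hij : i = j
    · rw [hij, h0]
    · exact this i (Finset.mem_erase.2 ⟨hij, hi⟩)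
  · rw [Finset.erase_eq_of_notMem hjI] at hI
    exact hI h hdeg hsum

theorem RootBound.merge [DecidableEq ι] (hB : RootBound k I S t c) {J : Finset ι} (hJ : J ⊆ I)
    {T : Finset (Fin n)} {u : ℕ} (hT : ∀ i ∈ J, T ⊆ S i ∧ u ≤ t i)
    (htight : ∑ i ∈ J, c i + T.card + u = k) {j : ι} (hj : j ∈ J) :
    RootBound k (insert j (I \ J)) (Function.update S j T) (Function.update t j u)
      (Function.update c j (∑ i ∈ J, c i)) := by
  constructor
  · intro i hi
    by_cases hij : i = j
    · subst hij
      simpa using htight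
    · simp only [Function.update_of_ne hij]
      have := Finset.mem_insert.1 hi
      exact hB.degree_add i (by simp_all)
  · intro L hL hLne V w hV
    have hsub : L.erase j ⊆ I \ J := by
      intro i hi
      obtain ⟨hij, hi⟩ := Finset.mem_erase.1 hi
      exact (Finset.mem_insert.1 (hL hi)).resolve_left hij
    have hsum : ∑ i ∈ L.erase j, Function.update c j (∑ i ∈ J, c i) i = ∑ i ∈ L.erase j, c i :=
      Finset.sum_congr rfl fun i hi => Function.update_of_ne (Finset.ne_of_mem_erase hi) _ _
    have hV' : ∀ i ∈ L.erase j, V ⊆ S i ∧ w ≤ t i := by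
      intro i hi
      have := hV i (Finset.mem_of_mem_erase hi)
      simpa only [Function.update_of_ne (Finset.ne_of_mem_erase hi)] using this
    by_cases hjL : j ∈ L
    · have hVj := hV j hjL
      simp only [Function.update_self] at hVj
      rw [← Finset.add_sum_erase _ _ hjL, hsum, Function.update_self]
      have hdisj : Disjoint J (L.erase j) :=
        Finset.disjoint_of_subset_right hsub Finset.disjoint_sdiff
      rw [← Finset.sum_union hdisj]
      refine hB.bound _ (Finset.union_subset hJ (hsub.trans Finset.sdiff_subset))
        ⟨j, Finset.mem_union_left _ hj⟩ V w fun i hi => ?_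
      rcases Finset.mem_union.1 hi with hi | hi
      · exact ⟨hVj.1.trans (hT i hi).1, hVj.2.trans (hT i hi).2⟩
      · exact hV' i hi
    · rw [Finset.erase_eq_of_notMem hjL] at hsum hV' hsub
      rw [hsum]
      exact hB.bound L (hsub.trans Finset.sdiff_subset) hLne V w hV'

theorem MultiplesIndep.of_merge [DecidableEq ι] (hB : RootBound k I S t c) {J : Finset ι}
    (hJ : J ⊆ I) {T : Finset (Fin n)} {u : ℕ} (hT : ∀ i ∈ J, T ⊆ S i ∧ u ≤ t i)
    (htight : ∑ i ∈ J, c i + T.card + u = k) {j : ι} (hj : j ∈ J)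
    (hIJ : MultiplesIndep F J S t c)
    (hI : MultiplesIndep F (insert j (I \ J)) (Function.update S j T) (Function.update t j u)
      (Function.update c j (∑ i ∈ J, c i))) : MultiplesIndep F I S t c := by
  intro h hdeg hsum
  set H := ∑ i ∈ J, h i * zeroRootPoly F (S i \ T) (t i - u) with hH
  have hHsum : H * zeroRootPoly F T u = ∑ i ∈ J, h i * zeroRootPoly F (S i) (t i) := by
    rw [hH, Finset.sum_mul]
    refine Finset.sum_congr rfl fun i hi => ?_
    rw [← zeroRootPoly_mul_sdiff (hT i hi).1 (hT i hi).2]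
    ring
  have hHdeg : H.degree < (∑ i ∈ J, c i : ℕ) := by
    refine (degree_sum_le _ _).trans_lt ((Finset.sup_lt_iff (WithBot.bot_lt_coe _)).2 ?_)
    intro i hi
    have hc := hdeg i (hJ hi)
    by_cases h0 : h i = 0
    · rw [h0, zero_mul, degree_zero]
      exact WithBot.bot_lt_coe _
    have hk := hB.degree_add i (hJ hi)
    have hcard := Finset.card_sdiff_add_card_eq_card (hT i hi).1
    have hu := (hT i hi).2
    rw [degree_mul, degree_zeroRootPoly, degree_eq_natDegree h0]
    rw [degree_eq_natDegree h0] at hc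
    norm_cast at hc ⊢
    omega
  have hne : ∀ i ∈ I \ J, i ≠ j := by
    rintro i hi rfl
    exact (Finset.mem_sdiff.1 hi).2 hj
  have hjn : j ∉ I \ J := fun hji => hne j hji rfl
  have hres := hI (Function.update h j H) (by
    intro i hi
    rcases Finset.mem_insert.1 hi with rfl | hi
    · simpa using hHdeg
    · simpa only [Function.update_of_ne (hne i hi)] using hdeg i (Finset.mem_sdiff.1 hi).1) (by
    rw [Finset.sum_insert hjn]
    simp only [Function.update_self]
    rw [hHsum, ← hsum, ← Finset.sum_sdiff hJ, add_comm]
    congr 1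
    refine Finset.sum_congr rfl fun i hi => ?_
    simp only [Function.update_of_ne (hne i hi)])
  have hH0 : H = 0 := by simpa using hres j (Finset.mem_insert_self _ _)
  have hJ0 := hIJ h (fun i hi => hdeg i (hJ hi)) (by rw [← hHsum, hH0, zero_mul])
  intro i hi
  by_cases hiJ : i ∈ J
  · exact hJ0 i hiJ
  · have hiIJ := Finset.mem_sdiff.2 ⟨hi, hiJ⟩
    simpa only [Function.update_of_ne (hne i hiIJ)] using
      hres i (Finset.mem_insert_of_mem hiIJ)

theorem RootBound.killVar (hB : RootBound k I S t c)
    (hnt : ∀ J ⊆ I, 2 ≤ J.card → J ≠ I → ∀ (T : Finset (Fin n)) (u : ℕ),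
      (∀ i ∈ J, T ⊆ S i ∧ u ≤ t i) → ∑ i ∈ J, c i + T.card + u ≠ k)
    {a : Fin n} {j : ι} (hj : j ∈ I) (htj : t j = 0) (ha : a ∉ S j) :
    RootBound k I (fun i => (S i).erase a) (fun i => t i + if a ∈ S i then 1 else 0) c := by
  have hdeg : ∀ i ∈ I, c i + ((S i).erase a).card + (t i + if a ∈ S i then 1 else 0) = k := by
    intro i hi
    have := hB.degree_add i hi
    by_cases h : a ∈ S i
    · have := Finset.card_erase_add_one h
      simp only [h, if_true]
      omega
    · simp only [h, if_false, Finset.erase_eq_of_notMem h]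
      omega
  refine ⟨hdeg, fun J hJ hne T u hT => ?_⟩
  have hTS : ∀ i ∈ J, T ⊆ S i := fun i hi => (hT i hi).1.trans (Finset.erase_subset _ _)
  have hu : ∀ i ∈ J, u - 1 ≤ t i := by
    intro i hi
    have := (hT i hi).2
    split_ifs at this <;> omega
  have hle := hB.bound J hJ hne T (u - 1) fun i hi => ⟨hTS i hi, hu i hi⟩
  by_cases hJI : J = I
  · have := (hT j (hJI ▸ hj)).2
    simp only [htj, ha, if_false] at this
    omega
  · by_cases hcard : 2 ≤ J.card
    · have := hnt J hJ hcard hJI T (u - 1) fun i hi => ⟨hTS i hi, hu i hi⟩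
      omega
    · have : J.card = 1 := by
        have := hne.card_pos
        omega
      obtain ⟨i, rfl⟩ := Finset.card_eq_one.1 this
      have hi := Finset.mem_singleton_self i
      have h1 := hdeg i (hJ hi)
      have h2 := Finset.card_le_card (hT i hi).1
      have h3 := (hT i hi).2
      rw [Finset.sum_singleton]
      omega

theorem RootBound.div_X (hB : RootBound (k + 1) I S t c) (ht : ∀ i ∈ I, t i ≠ 0) :
    RootBound k I S (fun i => t i - 1) c := by
  constructor
  · intro i hi
    have := hB.degree_add i hi
    have := ht i hi
    omega
  · intro J hJ hne T u hT
    have := hB.bound J hJ hne T (u + 1) fun i hi => ⟨(hT i hi).1, by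
      have := (hT i hi).2
      have := ht i (hJ hi)
      omega⟩
    omega

theorem MultiplesIndep.of_div_X (ht : ∀ i ∈ I, t i ≠ 0)
    (hI : MultiplesIndep F I S (fun i => t i - 1) c) : MultiplesIndep F I S t c := by
  intro h hdeg hsum
  refine hI h hdeg (mul_left_cancel₀ X_ne_zero ?_)
  rw [mul_zero, Finset.mul_sum, ← hsum]
  refine Finset.sum_congr rfl fun i hi => ?_
  obtain ⟨s, hs⟩ := Nat.exists_eq_succ_of_ne_zero (ht i hi)
  simp only [hs, Nat.succ_eq_add_one, zeroRootPoly_add_one, Nat.add_sub_cancel]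
  ring

theorem RootBound.div_X_of_unique [DecidableEq ι] (hB : RootBound (k + 1) I S t c) {j : ι}
    (hcj : c j ≠ 0) (htj : t j = 0) (ht : ∀ i ∈ I, i ≠ j → t i ≠ 0) :
    RootBound k I S (fun i => t i - 1) (Function.update c j (c j - 1)) := by
  constructor
  · intro i hi
    have := hB.degree_add i hi
    by_cases hij : i = j
    · subst hij
      rw [Function.update_self]
      omega
    · have := ht i hi hij
      rw [Function.update_of_ne hij]
      omega
  · intro J hJ hne T u hT
    by_cases hjJ : j ∈ J
    · have hu := (hT j hjJ).2
      have := hB.bound J hJ hne T 0 fun i hi => ⟨(hT i hi).1, Nat.zero_le _⟩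
      rw [← Finset.add_sum_erase _ _ hjJ] at this ⊢
      have hsum : ∑ i ∈ J.erase j, Function.update c j (c j - 1) i = ∑ i ∈ J.erase j, c i :=
        Finset.sum_congr rfl fun i hi => Function.update_of_ne (Finset.ne_of_mem_erase hi) _ _
      rw [hsum, Function.update_self]
      omega
    · have hij : ∀ i ∈ J, i ≠ j := fun i hi e => hjJ (e ▸ hi)
      have hsum : ∑ i ∈ J, Function.update c j (c j - 1) i = ∑ i ∈ J, c i :=
        Finset.sum_congr rfl fun i hi => Function.update_of_ne (hij i hi) _ _
      have := hB.bound J hJ hne T (u + 1) fun i hi => ⟨(hT i hi).1, by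
        have := (hT i hi).2
        have := ht i (hJ hi) (hij i hi)
        omega⟩
      rw [hsum]
      omega

theorem MultiplesIndep.of_div_X_of_unique [DecidableEq ι] {j : ι} (hj : j ∈ I) (hcj : c j ≠ 0)
    (htj : t j = 0) (ht : ∀ i ∈ I, i ≠ j → t i ≠ 0)
    (hI : MultiplesIndep F I S (fun i => t i - 1) (Function.update c j (c j - 1))) :
    MultiplesIndep F I S t c := by
  intro h hdeg hsum
  have hX : ∀ i ∈ I, i ≠ j →
      h i * zeroRootPoly F (S i) (t i) = X * (h i * zeroRootPoly F (S i) (t i - 1)) := by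
    intro i hi hij
    obtain ⟨s, hs⟩ := Nat.exists_eq_succ_of_ne_zero (ht i hi hij)
    rw [hs, Nat.succ_eq_add_one, zeroRootPoly_add_one, Nat.add_sub_cancel]
    ring
  have hcoeff : (h j).coeff 0 = 0 := by
    have := congrArg (fun p => coeff p 0) hsum
    simp only [finsetSum_coeff, coeff_zero] at this
    rw [Finset.sum_eq_single_of_mem j hj fun i hi hij => by
      rw [hX i hi hij, mul_coeff_zero, coeff_X_zero, zero_mul], mul_coeff_zero, htj,
      zeroRootPoly, pow_zero, one_mul] at this
    exact (mul_eq_zero.1 this).resolve_right (coeff_zero_rootPoly_ne_zero _)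
  obtain ⟨g, hg⟩ := X_dvd_iff.2 hcoeff
  have hres := hI (Function.update h j g) (by
    intro i hi
    by_cases hij : i = j
    · subst hij
      have hd := hdeg i hi
      rw [Function.update_self, Function.update_self]
      by_cases hg0 : g = 0
      · simp [hg0]
      rw [hg, degree_mul, degree_X, degree_eq_natDegree hg0] at hd
      rw [degree_eq_natDegree hg0]
      norm_cast at hd ⊢
      omega
    · rw [Function.update_of_ne hij, Function.update_of_ne hij]
      exact hdeg i hi) (by
    apply mul_left_cancel₀ X_ne_zero
    rw [mul_zero, Finset.mul_sum, ← hsum]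
    refine Finset.sum_congr rfl fun i hi => ?_
    by_cases hij : i = j
    · subst hij
      simp only [Function.update_self, hg, htj, mul_assoc]
    · rw [Function.update_of_ne hij, hX i hi hij])
  intro i hi
  have := hres i hi
  by_cases hij : i = j
  · subst hij
    rw [Function.update_self] at this
    rw [hg, this, mul_zero]
  · rwa [Function.update_of_ne hij] at this

theorem RootBound.multiplesIndep (hB : RootBound k I S t c) : MultiplesIndep F I S t c := by
  classical
  induction hM : k + I.card + ∑ i ∈ I, (S i).card using Nat.strong_induction_on
    generalizing k I S t c with
  | _ M ih =>
  subst hM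
  by_cases hc : ∃ j ∈ I, c j = 0
  · obtain ⟨j, hj, hcj⟩ := hc
    refine .of_erase hcj (ih _ ?_ (hB.mono (Finset.erase_subset j I)) rfl)
    have h1 := Finset.card_erase_lt_of_mem hj
    have h2 := Finset.add_sum_erase I (fun i => (S i).card) hj
    omega
  push Not at hc
  by_cases hnt : ∀ J ⊆ I, 2 ≤ J.card → J ≠ I → ∀ (T : Finset (Fin n)) (u : ℕ),
      (∀ i ∈ J, T ⊆ S i ∧ u ≤ t i) → ∑ i ∈ J, c i + T.card + u ≠ k
  swap
  · push Not at hnt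
    obtain ⟨J, hJ, hcard, hJI, T, u, hT, htight⟩ := hnt
    obtain ⟨j, hj⟩ : J.Nonempty := Finset.card_pos.1 (by omega)
    have hlt := Finset.card_lt_card (hJ.ssubset_of_ne hJI)
    have hjn : j ∉ I \ J := fun h => (Finset.mem_sdiff.1 h).2 hj
    have hs := Finset.sum_sdiff (f := fun i => (S i).card) hJ
    refine .of_merge hB hJ hT htight hj (ih _ ?_ (hB.mono hJ) rfl)
      (ih _ ?_ (hB.merge hJ hT htight hj) rfl)
    · omega
    · have h1 := Finset.card_sdiff_add_card_eq_card hJ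
      have h2 := Finset.card_le_card (hT j hj).1
      have h3 := Finset.single_le_sum (f := fun i => (S i).card) (fun _ _ => Nat.zero_le _) hj
      have h4 : ∑ i ∈ I \ J, (Function.update S j T i).card = ∑ i ∈ I \ J, (S i).card :=
        Finset.sum_congr rfl fun i hi => by
          rw [Function.update_of_ne]
          rintro rfl
          exact hjn hi
      rw [Finset.card_insert_of_notMem hjn, Finset.sum_insert hjn, h4, Function.update_self]
      omega
  rcases I.eq_empty_or_nonempty with rfl | ⟨i₀, hi₀⟩
  · intro _ _ _ i hi
    simp at hi
  obtain ⟨k, rfl⟩ : ∃ k', k = k' + 1 := Nat.exists_eq_succ_of_ne_zero (by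
    have := hB.degree_add i₀ hi₀
    have := hc i₀ hi₀
    omega)
  by_cases ht : ∀ i ∈ I, t i ≠ 0
  · exact .of_div_X ht (ih _ (by omega) (hB.div_X ht) rfl)
  push Not at ht
  obtain ⟨j, hj, htj⟩ := ht
  by_cases hkill : ∃ a, ∃ i ∈ I, a ∈ S i ∧ ∃ l ∈ I, t l = 0 ∧ a ∉ S l
  · obtain ⟨a, i, hi, hai, l, hl, htl, hal⟩ := hkill
    refine .of_killVar a (ih _ ?_ (hB.killVar hnt hl htl hal) rfl)
    have := Finset.sum_lt_sum (f := fun i => ((S i).erase a).card) (g := fun i => (S i).card)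
      (fun i _ => Finset.card_le_card (Finset.erase_subset _ _))
      ⟨i, hi, Finset.card_erase_lt_of_mem hai⟩
    omega
  push Not at hkill
  have ht : ∀ i ∈ I, i ≠ j → t i ≠ 0 := by
    intro i hi hij hti
    have hsub : S j ⊆ S i := fun a ha => hkill a j hj ha i hi hti
    have := hB.bound {i, j} (by simp [Finset.insert_subset_iff, hi, hj]) (by simp) (S j) 0
      (by simp [hsub])
    rw [Finset.sum_pair hij] at this
    have := hB.degree_add j hj
    have := hc i hi
    omega
  exact .of_div_X_of_unique hj (hc j hj) htj ht
    (ih _ (by omega) (hB.div_X_of_unique (hc j hj) htj ht) rfl)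

theorem Wdet_ne_zero_of_multiplesIndep {m : ℕ} {N : Fin m → Finset (Fin n)}
    (hdeg : ∀ i, (N i).card < m)
    (hI : MultiplesIndep F Finset.univ N (fun _ => 0) fun _ => 1) : Wdet F N ≠ 0 := by
  intro hW
  obtain ⟨v, hv, hMv⟩ := Matrix.exists_mulVec_eq_zero_iff.2 hW
  apply hv
  have hres := hI (fun i => C (v i)) (fun i _ => degree_C_le.trans_lt (by norm_num)) (by
    ext1 d
    simp only [zeroRootPoly, pow_zero, one_mul, finsetSum_coeff, coeff_C_mul, coeff_zero]
    by_cases hd : d < m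
    · have := congrFun hMv ⟨d, hd⟩
      simpa [Matrix.mulVec, dotProduct, mul_comm] using this
    · refine Finset.sum_eq_zero fun i _ => ?_
      rw [coeff_eq_zero_of_natDegree_lt, mul_zero]
      rw [natDegree_rootPoly]
      exact (hdeg i).trans_le (not_lt.1 hd))
  funext i
  exact C_eq_zero.1 (hres i (Finset.mem_univ i))

theorem rootBound_of_not_GRP {m : ℕ} {N : Fin m → Finset (Fin n)}
    (hdeg : ∀ i, (N i).card + 1 = m) (hN : ¬ GRP N) :
    RootBound m Finset.univ N (fun _ => 0) fun _ => 1 := by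
  refine ⟨fun i _ => by have := hdeg i; omega, fun J _ hne T u hT => ?_⟩
  obtain ⟨i, hi⟩ := hne
  have hu : u = 0 := Nat.le_zero.1 (hT i hi).2
  have hJ : J.card ≤ m := by simpa using Finset.card_le_univ J
  simp only [Finset.sum_const, smul_eq_mul, mul_one, hu, add_zero]
  by_cases h1 : 1 < J.card
  · by_contra hlt
    refine hN ⟨J.card, 0, h1, hJ, Nat.zero_le _, J, le_rfl, fun i _ => ?_, T, by omega,
      fun i hi => (hT i hi).1⟩
    have := hdeg i
    omega
  · have := Finset.card_le_card (hT i hi).1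
    have := hdeg i
    omega

end

/-- Theorem 4: for `m = 5` and degrees `d_1 = ⋯ = d_5 = 4`, if
`W(P_1, …, P_5) ≡ 0` then `{P_1, …, P_5}` has GRP. -/
theorem grp_of_Wdet_eq_zero_five (F : Type*) [Field F] {n : ℕ}
    (N : Fin 5 → Finset (Fin n))
    (hdeg : ∀ i, (N i).card = 4)
    (hW : Wdet F N = 0) : GRP N := by
  by_contra hN
  exact Wdet_ne_zero_of_multiplesIndep (fun i => by rw [hdeg i]; norm_num)
    (rootBound_of_not_GRP (fun i => by rw [hdeg i]) hN).multiplesIndep hW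
end

section
/- Let {P_1,…,P_m} be polynomials with root-sets N_i ⊆ N and degrees 0 ≤ d_i ≤ m−1 for i ∈ [m−1] and d_m = m−1, and write {P_i}_⋆ = {P_1,…,P_{m−1}}. Suppose {P_1,…,P_m} has the generalized non-rectangular property (GNRP). If S_1 and S_2 are two distinct strongly reducible (r,s)-subsets in {P_i}_⋆ with r + s = m, then the subfamilies of {P_i}_⋆ containing them are disjoint, i.e., {i ∈ [m−1] : S_1 ⊆ N_i} ∩ {i ∈ [m−1] : S_2 ⊆ N_i} = ∅. -/
/-- `S` is an `(r, s)`-subset in the subfamily of the polynomials indexed by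
`Q`: `S` is contained in the root-sets of `r` polynomials of the subfamily,
and `|S| = s`. -/
def IsRSsubset {n m : ℕ} (N : Fin m → Finset (Fin n)) (Q : Finset (Fin m))
    (r s : ℕ) (S : Finset (Fin n)) : Prop :=
  (∃ I : Finset (Fin m), I ⊆ Q ∧ I.card = r ∧ ∀ i ∈ I, S ⊆ N i) ∧ S.card = s

/-- An element `β` is removable (w.r.t. the family of `m + 1` polynomials, the
paper's `m` being `m + 1`) if `β` is a root of some but not all polynomials of
degree `m` (the paper's `m - 1`). -/
def RemovableElt {n m : ℕ} (N : Fin (m + 1) → Finset (Fin n)) (β : Fin n) : Prop :=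
  (∃ i, (N i).card = m ∧ β ∈ N i) ∧ (∃ i, (N i).card = m ∧ β ∉ N i)

/-- `S` is weakly reducible if `S` is contained in the root-set of a polynomial
of degree `m` (the paper's `m - 1`) and `S` has a removable element. -/
def WeaklyReducible {n m : ℕ} (N : Fin (m + 1) → Finset (Fin n))
    (S : Finset (Fin n)) : Prop :=
  (∃ i, (N i).card = m ∧ S ⊆ N i) ∧ ∃ β ∈ S, RemovableElt N β

/-- An `(r, s)`-subset has higher order than an `(r', s')`-subset if
`r + s > r' + s'`, or `r + s = r' + s'` and `r > r'`. -/
def HigherOrder (r s r' s' : ℕ) : Prop :=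
  r' + s' < r + s ∨ (r + s = r' + s' ∧ r' < r)

/-- A weakly reducible `(r, s)`-subset `S` (in the subfamily indexed by `Q`)
is strongly reducible if no other weakly reducible `(r', s')`-subset has
higher order than `S`. -/
def StronglyReducible {n m : ℕ} (N : Fin (m + 1) → Finset (Fin n))
    (Q : Finset (Fin (m + 1))) (r s : ℕ) (S : Finset (Fin n)) : Prop :=
  IsRSsubset N Q r s S ∧ WeaklyReducible N S ∧
    ∀ (r' s' : ℕ) (S' : Finset (Fin n)), IsRSsubset N Q r' s' S' →
      WeaklyReducible N S' → ¬ HigherOrder r' s' r s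

/-- Under GNRP, a nonempty family of `k` polynomials has at most `m + 1 - k` common roots. -/
theorem card_add_card_le_of_not_GRP {n m : ℕ} {N : Fin (m + 1) → Finset (Fin n)}
    (hdeg : ∀ i, (N i).card ≤ m) (hGNRP : ¬ GRP N) {I : Finset (Fin (m + 1))}
    (hI : I.Nonempty) {S : Finset (Fin n)} (hS : ∀ i ∈ I, S ⊆ N i) :
    I.card + S.card ≤ m + 1 := by
  by_contra! h
  have hIm : I.card ≤ m + 1 := by simpa using I.card_le_univ
  obtain ⟨i, hi⟩ := hI
  have hSm := (Finset.card_le_card (hS i hi)).trans (hdeg i)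
  exact hGNRP ⟨I.card, 0, by omega, hIm, Nat.zero_le _, I, le_rfl,
    fun j _ => by simpa using hdeg j, S, by omega, hS⟩

/-- The indices other than the last one whose root-sets contain `S`. -/
def supersetIndices {n m : ℕ} (N : Fin (m + 1) → Finset (Fin n)) (S : Finset (Fin n)) :
    Finset (Fin (m + 1)) :=
  (Finset.univ.image Fin.castSucc).filter fun j => S ⊆ N j

theorem mem_supersetIndices {n m : ℕ} {N : Fin (m + 1) → Finset (Fin n)}
    {S : Finset (Fin n)} {j : Fin (m + 1)} :
    j ∈ supersetIndices N S ↔ j ≠ Fin.last m ∧ S ⊆ N j := by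
  simp [supersetIndices]

/-- A strongly reducible `(r, s)`-subset lies in exactly `r` root-sets of the subfamily. -/
theorem StronglyReducible.card_supersetIndices {n m : ℕ} {N : Fin (m + 1) → Finset (Fin n)}
    {r s : ℕ} {S : Finset (Fin n)}
    (h : StronglyReducible N (Finset.univ.image Fin.castSucc) r s S) :
    (supersetIndices N S).card = r := by
  obtain ⟨⟨⟨I, hIQ, hIr, hIS⟩, hs⟩, hw, hmax⟩ := h
  have hle : I.card ≤ (supersetIndices N S).card :=
    Finset.card_le_card fun j hj => Finset.mem_filter.2 ⟨hIQ hj, hIS j hj⟩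
  have := hmax (supersetIndices N S).card s S
    ⟨⟨_, Finset.filter_subset _ _, rfl, fun j hj => (mem_supersetIndices.1 hj).2⟩, hs⟩ hw
  unfold HigherOrder at this
  omega

/-- Lemma 5.  The family has `m + 1` polynomials (the paper's `m` is `m + 1`):
degrees satisfy `d_i ≤ m` for all `i` and `d_{last} = m`; the subfamily
`{P_i}_⋆` consists of the first `m` polynomials (indices `Fin.castSucc i`).
If the whole family has GNRP, then two distinct strongly reducible
`(r, s)`-subsets in `{P_i}_⋆` with `r + s = m + 1` (the paper's `r + s = m`)
belong to disjoint subfamilies of `{P_i}_⋆`. -/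
theorem strongly_reducible_disjoint {n m : ℕ} (N : Fin (m + 1) → Finset (Fin n))
    (hdeg : ∀ i, (N i).card ≤ m)
    (hlast : (N (Fin.last m)).card = m)
    (hGNRP : ¬ GRP N)
    (r s : ℕ) (hrs : r + s = m + 1)
    (S₁ S₂ : Finset (Fin n)) (hne : S₁ ≠ S₂)
    (h₁ : StronglyReducible N (Finset.univ.image Fin.castSucc) r s S₁)
    (h₂ : StronglyReducible N (Finset.univ.image Fin.castSucc) r s S₂) :
    ∀ i : Fin m, ¬ (S₁ ⊆ N (Fin.castSucc i) ∧ S₂ ⊆ N (Fin.castSucc i)) := by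
  rintro i ⟨hi₁, hi₂⟩
  have hr₁ := h₁.card_supersetIndices
  have hr₂ := h₂.card_supersetIndices
  obtain ⟨⟨-, hs₁⟩, ⟨⟨j, hjm, hj⟩, -⟩, hmax⟩ := h₁
  have hs₂ := h₂.1.2
  set I₁ := supersetIndices N S₁ with hI₁
  set I₂ := supersetIndices N S₂ with hI₂
  have hlast₁ : Fin.last m ∉ I₁ := by simp [hI₁, mem_supersetIndices]
  have hlast₂ : Fin.last m ∉ I₂ := by simp [hI₂, mem_supersetIndices]
  have hiI₁ : i.castSucc ∈ I₁ := mem_supersetIndices.2 ⟨Fin.castSucc_ne_last i, hi₁⟩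
  have hiI₂ : i.castSucc ∈ I₂ := mem_supersetIndices.2 ⟨Fin.castSucc_ne_last i, hi₂⟩
  have hsub₁ : ∀ k ∈ I₁, S₁ ⊆ N k := fun k hk => (mem_supersetIndices.1 hk).2
  have hsub₂ : ∀ k ∈ I₂, S₂ ⊆ N k := fun k hk => (mem_supersetIndices.1 hk).2
  have hunion : (I₁ ∩ I₂).card + (S₁ ∪ S₂).card ≤ m + 1 :=
    card_add_card_le_of_not_GRP hdeg hGNRP ⟨_, Finset.mem_inter.2 ⟨hiI₁, hiI₂⟩⟩ fun k hk =>
      Finset.union_subset (hsub₁ k (Finset.mem_inter.1 hk).1) (hsub₂ k (Finset.mem_inter.1 hk).2)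
  have hinter : ∀ k ∈ I₁ ∪ I₂, S₁ ∩ S₂ ⊆ N k := fun k hk => by
    rcases Finset.mem_union.1 hk with hk | hk
    · exact Finset.inter_subset_left.trans (hsub₁ k hk)
    · exact Finset.inter_subset_right.trans (hsub₂ k hk)
  have hI := Finset.card_union_add_card_inter I₁ I₂
  have hS := Finset.card_union_add_card_inter S₁ S₂
  have hSlt : s < (S₁ ∪ S₂).card := by
    by_contra! hle
    have e₁ := Finset.eq_of_subset_of_card_le
      (Finset.subset_union_left : S₁ ⊆ S₁ ∪ S₂) (by omega)
    have e₂ := Finset.eq_of_subset_of_card_le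
      (Finset.subset_union_right : S₂ ⊆ S₁ ∪ S₂) (by omega)
    exact hne (e₁.trans e₂.symm)
  by_cases hw : S₁ ∩ S₂ ⊆ N (Fin.last m)
  · have := card_add_card_le_of_not_GRP hdeg hGNRP
      (I := insert (Fin.last m) (I₁ ∪ I₂)) (Finset.insert_nonempty _ _)
      (S := S₁ ∩ S₂) (by simpa [hw] using hinter)
    rw [Finset.card_insert_of_notMem (by simp [hlast₁, hlast₂])] at this
    omega
  · obtain ⟨β, hβ, hβlast⟩ := Finset.not_subset.1 hw
    have hjβ := hj (Finset.mem_inter.1 hβ).1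
    refine hmax (I₁ ∪ I₂).card (S₁ ∩ S₂).card (S₁ ∩ S₂)
      ⟨⟨I₁ ∪ I₂, ?_, rfl, hinter⟩, rfl⟩
      ⟨⟨j, hjm, Finset.inter_subset_left.trans hj⟩,
        β, hβ, ⟨j, hjm, hjβ⟩, Fin.last m, hlast, hβlast⟩ ?_
    · exact Finset.union_subset (Finset.filter_subset _ _) (Finset.filter_subset _ _)
    · unfold HigherOrder
      omega
end

section
/- Let {P_1,…,P_m} be polynomials with root-sets N_i ⊆ N of sizes 0 ≤ d_i ≤ m−1, at least two of which have degree m−1. If {P_1,…,P_m} has the generalized non-rectangular property (GNRP), then there exists a weakly reducible subset in {P_1,…,P_m}; equivalently, some index i with d_i = m−1 admits an element β ∈ N_i that is removable. (Hence each round of the reduction process can be performed, and the process terminates.) -/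
/-- In a family with GNRP, two distinct polynomials of maximal degree have a root that
belongs to exactly one of them, and this root is removable. -/
theorem exists_mem_removableElt {n m : ℕ} (N : Fin (m + 1) → Finset (Fin n))
    (hdeg : ∀ i, (N i).card ≤ m)
    (htwo : 2 ≤ (Finset.univ.filter (fun i => (N i).card = m)).card)
    (hGNRP : ¬ GRP N) :
    ∃ i : Fin (m + 1), (N i).card = m ∧ ∃ β ∈ N i, RemovableElt N β := by
  obtain ⟨i, hi, j, hj, hij⟩ := Finset.one_lt_card.mp htwo
  simp only [Finset.mem_filter, Finset.mem_univ, true_and] at hi hj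
  have hm : 1 ≤ m := by
    have := Fin.val_ne_of_ne hij
    omega
  have hsub : ¬ N i ⊆ N j := by
    intro h
    refine hGNRP ⟨2, 0, by omega, by omega, by omega, {i, j}, (Finset.card_pair hij).ge,
      fun a _ => (hdeg a).trans (by omega), N i, by omega, ?_⟩
    simpa using h
  obtain ⟨β, hβi, hβj⟩ := Finset.not_subset.mp hsub
  exact ⟨i, hi, β, hβi, ⟨i, hi, hβi⟩, ⟨j, hj, hβj⟩⟩

/-- The family has `m + 1` polynomials (the paper's `m` is `m + 1`), with
degrees `d_i ≤ m` and at least two polynomials of degree `m` (the paper's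
`m - 1`).  If the family has GNRP, then there exists a weakly reducible
subset; equivalently, some polynomial of degree `m` has a removable root. -/
theorem exists_weakly_reducible {n m : ℕ} (N : Fin (m + 1) → Finset (Fin n))
    (hdeg : ∀ i, (N i).card ≤ m)
    (htwo : 2 ≤ (Finset.univ.filter (fun i => (N i).card = m)).card)
    (hGNRP : ¬ GRP N) :
    (∃ S : Finset (Fin n), WeaklyReducible N S) ∧
    ∃ i : Fin (m + 1), (N i).card = m ∧ ∃ β ∈ N i, RemovableElt N β := by
  obtain ⟨i, hi, β, hβ, hrem⟩ := exists_mem_removableElt N hdeg htwo hGNRP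
  exact ⟨⟨N i, ⟨i, hi, subset_rfl⟩, β, hβ, hrem⟩, i, hi, β, hβ, hrem⟩
end

section
/- Let M be an m×n binary matrix each of whose rows has support of size exactly n−m+1 (with 1 < m ≤ n), and for each i ∈ [m] let N_i = {α_j : j ∈ [n] ∖ supp(M_i)}, so that each P_i(α) = ∏_{γ ∈ N_i}(α − γ) has degree m−1. Then M satisfies the MDS condition if and only if {P_1,…,P_m} has the non-rectangular property (NRP). -/
/-- The support of the `i`-th row of a binary matrix `M`. -/
def rowSupp {m n : ℕ} (M : Matrix (Fin m) (Fin n) Bool) (i : Fin m) :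
    Finset (Fin n) :=
  Finset.univ.filter (fun j => M i j = true)

/-- The MDS condition: `|∪_{i ∈ I} supp(M_i)| ≥ n - m + |I|` for every
nonempty `I ⊆ [m]`. -/
def MDSCondition {m n : ℕ} (M : Matrix (Fin m) (Fin n) Bool) : Prop :=
  ∀ I : Finset (Fin m), I.Nonempty →
    n - m + I.card ≤ (I.biUnion (fun i => rowSupp M i)).card

/-- Rectangular property for `m` polynomials of degree `m - 1` given by their
root-sets: for some `1 < k ≤ m`, there exist at least `k` polynomials with at
least `m - k + 1` common roots. -/
def RP {n m : ℕ} (N : Fin m → Finset (Fin n)) : Prop :=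
  ∃ k : ℕ, 1 < k ∧ k ≤ m ∧
    ∃ I : Finset (Fin m), k ≤ I.card ∧
      ∃ S : Finset (Fin n), m - k + 1 ≤ S.card ∧ ∀ i ∈ I, S ⊆ N i

/-- Fact 1: for a binary `m × n` matrix (with `1 < m ≤ n`) whose rows all have
supports of size `n - m + 1`, and `N_i` the complement of the support of the
`i`-th row (so each `P_i` has degree `m - 1`), the MDS condition holds iff
`{P_1, …, P_m}` has NRP. -/
theorem mds_condition_iff_nrp {m n : ℕ} (hm : 1 < m) (hmn : m ≤ n)
    (M : Matrix (Fin m) (Fin n) Bool)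
    (hsupp : ∀ i, (rowSupp M i).card = n - m + 1) :
    MDSCondition M ↔ ¬ RP (fun i => (rowSupp M i)ᶜ) := by
  constructor
  · rintro h ⟨k, hk, hkm, I, hI, S, hS, hsub⟩
    have hne : I.Nonempty := Finset.card_pos.mp (by omega)
    have hU : I.biUnion (fun i => rowSupp M i) ⊆ Sᶜ :=
      Finset.biUnion_subset.mpr fun i hi => Finset.subset_compl_comm.mp (hsub i hi)
    have hcard := Finset.card_le_card hU
    rw [Finset.card_compl, Fintype.card_fin] at hcard
    have := h I hne
    omega
  · intro h I hne
    by_contra hlt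
    obtain ⟨i, hi⟩ := hne
    have hle := Finset.card_le_card (Finset.subset_biUnion_of_mem (fun i => rowSupp M i) hi)
    have hIm := card_finset_fin_le I
    have hUn := card_finset_fin_le (I.biUnion fun i => rowSupp M i)
    have hMi := hsupp i
    refine h ⟨I.card, by omega, hIm, I, le_rfl, (I.biUnion fun i => rowSupp M i)ᶜ, ?_, ?_⟩
    · rw [Finset.card_compl, Fintype.card_fin]
      omega
    · intro j hj
      exact Finset.compl_subset_compl.mpr
        (Finset.subset_biUnion_of_mem (fun i => rowSupp M i) hj)
end

section
/- Let 1 < m ≤ 5 and m ≤ n, let M be an m×n binary matrix satisfying the MDS condition, and let F be a finite field with |F| ≥ n + m − 1. Then there exists a matrix G ∈ F^{m×n} such that G fits M and every m×m submatrix of G is nonsingular; that is, G is the generator matrix of an [n,m] MDS code over F fitting M. -/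
open Polynomial in
/-- The monic polynomial `∏ j ∈ Z, (X - x_j)` over the polynomial ring in the variables `x_j`. -/
noncomputable def genericNodePoly (F : Type*) [Field F] {σ : Type*} (Z : Finset σ) :
    (MvPolynomial σ F)[X] :=
  ∏ j ∈ Z, (X - C (MvPolynomial.X j))

/-- A family of zero patterns `x_j` for `j ∈ Z i` together with a zero of order `t i` at the origin,
leaving `r i` degrees of freedom below degree `k`, satisfies the generalised MDS condition. The
intersection of the patterns over `I` is encoded by its lower bounds `(C, c)`. -/
structure IsAdmissible {ι σ : Type*} (k : ℕ) (s : Finset ι) (Z : ι → Finset σ) (t r : ι → ℕ) :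
    Prop where
  size : ∀ i ∈ s, r i + (Z i).card + t i = k
  bound : ∀ I ⊆ s, I.Nonempty → ∀ (C : Finset σ) (c : ℕ), (∀ i ∈ I, C ⊆ Z i) →
    (∀ i ∈ I, c ≤ t i) → ∑ i ∈ I, r i + C.card + c ≤ k

open Polynomial in
/-- The polynomials `X ^ (e + t i) * ∏ j ∈ Z i, (X - x_j)` for `i ∈ s` and `e < r i` are linearly
independent over the polynomial ring in the variables `x_j`. -/
def NodePolyIndep (F : Type*) [Field F] {ι σ : Type*} (s : Finset ι) (Z : ι → Finset σ)
    (t r : ι → ℕ) : Prop :=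
  ∀ q : ι → (MvPolynomial σ F)[X], (∀ i ∈ s, q i ∈ degreeLT (MvPolynomial σ F) (r i)) →
    ∑ i ∈ s, q i * (X ^ t i * genericNodePoly F (Z i)) = 0 → ∀ i ∈ s, q i = 0

namespace IsAdmissible

variable {ι σ : Type*} {k : ℕ} {s : Finset ι} {Z : ι → Finset σ} {t r : ι → ℕ}

theorem mono (h : IsAdmissible k s Z t r) {s' : Finset ι} (hs : s' ⊆ s) :
    IsAdmissible k s' Z t r :=
  ⟨fun i hi => h.size i (hs hi), fun I hI => h.bound I (hI.trans hs)⟩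

theorem tsub_one (h : IsAdmissible k s Z t r) (ht : ∀ i ∈ s, 0 < t i) :
    IsAdmissible (k - 1) s Z (fun i => t i - 1) r where
  size i hi := by
    have h1 := h.size i hi
    have h2 := ht i hi
    omega
  bound I hI hne C c hC hc := by
    have := h.bound I hI hne C (c + 1) hC fun i hi => by
      have h1 := hc i hi
      have h2 := ht i (hI hi)
      omega
    omega

open Classical in
theorem update_succ (h : IsAdmissible k s Z t r) {i₀ : ι} (hr : 0 < r i₀) :
    IsAdmissible k s Z (Function.update t i₀ (t i₀ + 1)) (Function.update r i₀ (r i₀ - 1)) where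
  size i hi := by
    have h1 := h.size i hi
    by_cases hi0 : i = i₀
    · subst hi0
      simp only [Function.update_self]
      omega
    · simpa [Function.update_of_ne hi0] using h1
  bound I hI hne C c hC hc := by
    by_cases hmem : i₀ ∈ I
    · have hb := h.bound I hI hne C (c - 1) hC fun i hi => by
        have h1 := hc i hi
        by_cases hi0 : i = i₀
        · subst hi0
          simp only [Function.update_self] at h1
          omega
        · rw [Function.update_of_ne hi0] at h1
          omega
      rw [Finset.sum_update_of_mem hmem]
      rw [← Finset.add_sum_erase I r hmem, ← Finset.sdiff_singleton_eq_erase] at hb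
      omega
    · have hne' : ∀ i ∈ I, i ≠ i₀ := fun i hi hi0 => hmem (hi0 ▸ hi)
      rw [Finset.sum_update_of_notMem hmem]
      exact h.bound I hI hne C c hC fun i hi => by
        simpa [Function.update_of_ne (hne' i hi)] using hc i hi

open Classical in
/-- Replacing the patterns of a tight subfamily `I` by their intersection `(C, c)`. -/
theorem contract (h : IsAdmissible k s Z t r) {I : Finset ι} (hI : I ⊆ s) {i₀ : ι} (hi₀ : i₀ ∈ I)
    {C : Finset σ} {c : ℕ} (hC : ∀ i ∈ I, C ⊆ Z i) (hc : ∀ i ∈ I, c ≤ t i)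
    (htight : k ≤ ∑ i ∈ I, r i + C.card + c) :
    IsAdmissible k (insert i₀ (s \ I)) (Function.update Z i₀ C) (Function.update t i₀ c)
      (Function.update r i₀ (∑ i ∈ I, r i)) where
  size i hi := by
    by_cases hi0 : i = i₀
    · subst hi0
      have := h.bound I hI ⟨i, hi₀⟩ C c hC hc
      simp only [Function.update_self]
      omega
    · simp only [Function.update_of_ne hi0]
      exact h.size i (Finset.mem_sdiff.1 (Finset.mem_of_mem_insert_of_ne hi hi0)).1
  bound J hJ hne D d hD hd := by
    have hJ' : ∀ i ∈ J, i ≠ i₀ → i ∈ s \ I := fun i hi hi0 =>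
      Finset.mem_of_mem_insert_of_ne (hJ hi) hi0
    by_cases hmem : i₀ ∈ J
    · have hDC : D ⊆ C := by simpa using hD i₀ hmem
      have hdc : d ≤ c := by simpa using hd i₀ hmem
      have hdisj : Disjoint I (J \ {i₀}) := by
        rw [Finset.disjoint_left]
        intro i hi hiJ
        simp only [Finset.mem_sdiff, Finset.mem_singleton] at hiJ
        exact (Finset.mem_sdiff.1 (hJ' i hiJ.1 hiJ.2)).2 hi
      rw [Finset.sum_update_of_mem hmem, ← Finset.sum_union hdisj]
      have key : ∀ i ∈ I ∪ J \ {i₀}, i ∈ s ∧ D ⊆ Z i ∧ d ≤ t i := by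
        intro i hi
        rcases Finset.mem_union.1 hi with hi | hi
        · exact ⟨hI hi, hDC.trans (hC i hi), hdc.trans (hc i hi)⟩
        · simp only [Finset.mem_sdiff, Finset.mem_singleton] at hi
          refine ⟨(Finset.mem_sdiff.1 (hJ' i hi.1 hi.2)).1, ?_, ?_⟩
          · simpa [Function.update_of_ne hi.2] using hD i hi.1
          · simpa [Function.update_of_ne hi.2] using hd i hi.1
      exact h.bound _ (fun i hi => (key i hi).1) ⟨i₀, Finset.mem_union_left _ hi₀⟩ D d
        (fun i hi => (key i hi).2.1) fun i hi => (key i hi).2.2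
    · have hne' : ∀ i ∈ J, i ≠ i₀ := fun i hi hi0 => hmem (hi0 ▸ hi)
      rw [Finset.sum_update_of_notMem hmem]
      refine h.bound J (fun i hi => (Finset.mem_sdiff.1 (hJ' i hi (hne' i hi))).1) hne D d ?_ ?_
      · intro i hi
        simpa [Function.update_of_ne (hne' i hi)] using hD i hi
      · intro i hi
        simpa [Function.update_of_ne (hne' i hi)] using hd i hi

open Classical in
/-- Specialising the node `x_j` to the origin, when no proper subfamily is tight. -/
theorem merge (h : IsAdmissible k s Z t r) {i₀ : ι} (hi₀ : i₀ ∈ s) (ht : t i₀ = 0) {j : σ}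
    (hj : j ∉ Z i₀)
    (hloose : ∀ I ⊆ s, 1 < I.card → I.card < s.card → ∀ (C : Finset σ) (c : ℕ),
      (∀ i ∈ I, C ⊆ Z i) → (∀ i ∈ I, c ≤ t i) → ∑ i ∈ I, r i + C.card + c < k) :
    IsAdmissible k s (fun i => (Z i).erase j) (fun i => t i + if j ∈ Z i then 1 else 0) r where
  size i hi := by
    have h1 := h.size i hi
    split_ifs with hji
    · have := Finset.card_erase_add_one hji
      omega
    · rw [Finset.erase_eq_of_notMem hji]
      omega
  bound I hI hne C c hC hc := by
    have hC' : ∀ i ∈ I, C ⊆ Z i := fun i hi => (hC i hi).trans (Finset.erase_subset _ _)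
    rcases Nat.lt_or_ge 1 I.card with h1 | h1
    · rcases (Finset.card_le_card hI).lt_or_eq with h2 | h2
      · have := hloose I hI h1 h2 C (c - 1) hC' fun i hi => by
          have h3 := hc i hi
          split_ifs at h3 <;> omega
        omega
      · obtain rfl := Finset.eq_of_subset_of_card_le hI h2.ge
        have hc0 := hc i₀ hi₀
        rw [if_neg hj, ht] at hc0
        exact h.bound I hI hne C c hC' fun i _ => by omega
    · obtain ⟨i, rfl⟩ := Finset.card_eq_one.1 (le_antisymm h1 hne.card_pos)
      have hi : i ∈ ({i} : Finset ι) := Finset.mem_singleton_self i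
      have h2 := h.size i (hI hi)
      have h3 := hc i hi
      have h4 := Finset.card_le_card (hC i hi)
      rw [Finset.sum_singleton]
      split_ifs at h3 with hji
      · have := Finset.card_erase_add_one hji
        omega
      · rw [Finset.erase_eq_of_notMem hji] at h4
        omega

end IsAdmissible

section NodePoly

open Polynomial

variable {F : Type*} [Field F] {ι σ : Type*}

theorem genericNodePoly_monic (Z : Finset σ) : (genericNodePoly F Z).Monic :=
  monic_prod_of_monic _ _ fun _ _ => monic_X_sub_C _

theorem genericNodePoly_natDegree (Z : Finset σ) : (genericNodePoly F Z).natDegree = Z.card := by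
  simp [genericNodePoly, natDegree_prod_of_monic _ _ fun i (_ : i ∈ Z) =>
    monic_X_sub_C (MvPolynomial.X i : MvPolynomial σ F)]

theorem genericNodePoly_coeff_zero_ne_zero (Z : Finset σ) :
    (genericNodePoly F Z).coeff 0 ≠ 0 := by
  rw [coeff_zero_eq_eval_zero, genericNodePoly, eval_prod]
  exact Finset.prod_ne_zero_iff.2 fun j _ => by simp

theorem genericNodePoly_mul_sdiff [DecidableEq σ] {Z C : Finset σ} (h : C ⊆ Z) :
    genericNodePoly F (Z \ C) * genericNodePoly F C = genericNodePoly F Z :=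
  Finset.prod_sdiff h

theorem mul_mem_degreeLT_of_monic {R : Type*} [CommRing R] [IsDomain R] {p q : R[X]} {a b : ℕ}
    (hp : p ∈ degreeLT R a) (hq : q.Monic) (hab : a + q.natDegree ≤ b) :
    p * q ∈ degreeLT R b := by
  rw [mem_degreeLT] at hp ⊢
  rcases eq_or_ne p 0 with rfl | h0
  · simp
  rw [degree_eq_natDegree (mul_ne_zero h0 hq.ne_zero), natDegree_mul h0 hq.ne_zero]
  rw [degree_eq_natDegree h0] at hp
  have := Nat.cast_lt.1 hp
  exact_mod_cast (by omega : p.natDegree + q.natDegree < b)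

open Classical in
/-- The specialisation `x_j = 0`. -/
noncomputable def zeroVar (F : Type*) [Field F] {σ : Type*} (j : σ) :
    MvPolynomial σ F →ₐ[F] MvPolynomial σ F :=
  MvPolynomial.aeval fun i => if i = j then 0 else MvPolynomial.X i

theorem X_dvd_sub_zeroVar (j : σ) (p : MvPolynomial σ F) :
    MvPolynomial.X j ∣ p - zeroVar F j p := by
  induction p using MvPolynomial.induction_on with
  | C a => simp [zeroVar]
  | add p q hp hq =>
    rw [map_add, add_sub_add_comm]
    exact dvd_add hp hq
  | mul_X p i hp =>
    rw [map_mul]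
    by_cases hij : i = j
    · subst hij
      simp [zeroVar]
    · have : zeroVar F j (MvPolynomial.X i) = MvPolynomial.X i := by simp [zeroVar, hij]
      rw [this, ← sub_mul]
      exact hp.mul_right _

theorem C_X_dvd_of_map_zeroVar_eq_zero {j : σ} {p : (MvPolynomial σ F)[X]}
    (h : p.map (zeroVar F j : MvPolynomial σ F →+* MvPolynomial σ F) = 0) :
    C (MvPolynomial.X j) ∣ p := by
  rw [C_dvd_iff_dvd_coeff]
  intro n
  have h1 := congrArg (fun f => coeff f n) h
  simp only [coeff_map, coeff_zero, RingHom.coe_coe] at h1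
  simpa [h1] using X_dvd_sub_zeroVar j (p.coeff n)

open Classical in
theorem genericNodePoly_map_zeroVar (j : σ) (Z : Finset σ) :
    (genericNodePoly F Z).map (zeroVar F j : MvPolynomial σ F →+* MvPolynomial σ F) =
      X ^ (if j ∈ Z then 1 else 0) * genericNodePoly F (Z.erase j) := by
  have key : ∀ Y : Finset σ, j ∉ Y →
      (genericNodePoly F Y).map (zeroVar F j : MvPolynomial σ F →+* MvPolynomial σ F) =
        genericNodePoly F Y := by
    intro Y hY
    rw [genericNodePoly, Polynomial.map_prod]
    refine Finset.prod_congr rfl fun i hi => ?_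
    have : i ≠ j := fun hij => hY (hij ▸ hi)
    simp [zeroVar, this]
  split_ifs with hj
  · conv_lhs => rw [genericNodePoly, ← Finset.mul_prod_erase _ _ hj, Polynomial.map_mul]
    have := key (Z.erase j) (Finset.notMem_erase j Z)
    rw [genericNodePoly] at this
    rw [this]
    simp [zeroVar, genericNodePoly]
  · rw [Finset.erase_eq_of_notMem hj, key Z hj]
    simp

variable {k : ℕ} {s : Finset ι} {Z : ι → Finset σ} {t r : ι → ℕ}

open Classical in
theorem NodePolyIndep.of_merge {j : σ}
    (h : NodePolyIndep F s (fun i => (Z i).erase j) (fun i => t i + if j ∈ Z i then 1 else 0) r) :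
    NodePolyIndep F s Z t r := by
  have key : ∀ (N : ℕ) (q : ι → (MvPolynomial σ F)[X]),
      (∀ i ∈ s, q i ∈ degreeLT (MvPolynomial σ F) (r i)) →
      ∑ i ∈ s, q i * (X ^ t i * genericNodePoly F (Z i)) = 0 →
      ∀ i ∈ s, C (MvPolynomial.X j) ^ N ∣ q i := by
    intro N
    induction N with
    | zero => simp
    | succ N ih =>
      intro q hq hsum
      have hdvd : ∀ i ∈ s, C (MvPolynomial.X j) ∣ q i := by
        intro i hi
        refine C_X_dvd_of_map_zeroVar_eq_zero (h (fun i => (q i).map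
          (zeroVar F j : MvPolynomial σ F →+* MvPolynomial σ F)) ?_ ?_ i hi)
        · intro i hi
          have := hq i hi
          rw [mem_degreeLT] at this ⊢
          exact degree_map_le.trans_lt this
        · have := congrArg (Polynomial.map
            (zeroVar F j : MvPolynomial σ F →+* MvPolynomial σ F)) hsum
          simpa [Polynomial.map_sum, genericNodePoly_map_zeroVar, pow_add, mul_assoc] using this
      choose! q' hq' using hdvd
      have hX : (C (MvPolynomial.X j) : (MvPolynomial σ F)[X]) ≠ 0 := by simp
      have := ih q' (fun i hi => by
        have h1 := hq i hi
        rw [mem_degreeLT] at h1 ⊢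
        rwa [hq' i hi, degree_mul, degree_C (by simp), zero_add] at h1) (by
        refine (mul_eq_zero.1 ?_).resolve_left hX
        rw [Finset.mul_sum, ← hsum]
        refine Finset.sum_congr rfl fun i hi => ?_
        rw [hq' i hi, mul_assoc])
      intro i hi
      rw [hq' i hi, pow_succ']
      exact mul_dvd_mul_left _ (this i hi)
  intro q hq hsum i hi
  by_contra h0
  have hunit : ¬ IsUnit (C (MvPolynomial.X j) : (MvPolynomial σ F)[X]) := by
    rw [isUnit_C]
    exact (MvPolynomial.X_prime (i := j)).not_isUnit
  obtain ⟨N, hN⟩ := FiniteMultiplicity.of_not_isUnit hunit h0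
  exact hN (key _ q hq hsum i hi)

theorem NodePolyIndep.of_tsub_one (h : NodePolyIndep F s Z (fun i => t i - 1) r)
    (ht : ∀ i ∈ s, 0 < t i) : NodePolyIndep F s Z t r := by
  intro q hq hsum
  refine h q hq ((mul_eq_zero.1 ?_).resolve_left (X_ne_zero (R := MvPolynomial σ F)))
  rw [Finset.mul_sum, ← hsum]
  refine Finset.sum_congr rfl fun i hi => ?_
  conv_rhs => rw [← Nat.sub_add_cancel (ht i hi), pow_succ]
  ring

open Classical in
theorem NodePolyIndep.of_erase {i₀ : ι} (h : NodePolyIndep F (s.erase i₀) Z t r)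
    (hi₀ : i₀ ∈ s) (hr : r i₀ = 0) : NodePolyIndep F s Z t r := by
  intro q hq hsum
  have h0 : q i₀ = 0 := by
    have := hq i₀ hi₀
    rw [hr, mem_degreeLT] at this
    simpa [Polynomial.degree_eq_bot] using this
  rw [← Finset.add_sum_erase _ _ hi₀, h0, zero_mul, zero_add] at hsum
  have := h q (fun i hi => hq i (Finset.mem_of_mem_erase hi)) hsum
  intro i hi
  by_cases hi0 : i = i₀
  · rw [hi0, h0]
  · exact this i (Finset.mem_erase.2 ⟨hi0, hi⟩)

open Classical in
theorem NodePolyIndep.of_update_succ {i₀ : ι}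
    (h : NodePolyIndep F s Z (Function.update t i₀ (t i₀ + 1)) (Function.update r i₀ (r i₀ - 1)))
    (hi₀ : i₀ ∈ s) (ht₀ : t i₀ = 0) (ht : ∀ i ∈ s, i ≠ i₀ → 0 < t i) :
    NodePolyIndep F s Z t r := by
  intro q hq hsum
  have hcoeff : (q i₀).coeff 0 = 0 := by
    have h1 := congrArg (fun f => coeff f 0) hsum
    simp only [finsetSum_coeff, coeff_zero] at h1
    rw [Finset.sum_eq_single_of_mem i₀ hi₀ fun i hi hne => by
      simp [mul_coeff_zero, (ht i hi hne).ne]] at h1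
    simp only [mul_coeff_zero, ht₀, pow_zero, one_mul] at h1
    exact (mul_eq_zero.1 h1).resolve_right (genericNodePoly_coeff_zero_ne_zero _)
  obtain ⟨p, hp⟩ := X_dvd_iff.2 hcoeff
  have key := h (Function.update q i₀ p) (fun i hi => by
    by_cases hi0 : i = i₀
    · subst hi0
      simp only [Function.update_self]
      have h1 := hq i hi
      rcases eq_or_ne p 0 with rfl | hp0
      · exact Submodule.zero_mem _
      rw [mem_degreeLT] at h1 ⊢
      rw [hp, degree_eq_natDegree (mul_ne_zero X_ne_zero hp0), natDegree_X_mul hp0] at h1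
      rw [degree_eq_natDegree hp0]
      have := Nat.cast_lt.1 h1
      exact_mod_cast (by omega : p.natDegree < r i - 1)
    · simpa [Function.update_of_ne hi0] using hq i hi) (by
    rw [← hsum]
    refine Finset.sum_congr rfl fun i _ => ?_
    by_cases hi0 : i = i₀
    · subst hi0
      simp only [Function.update_self, hp, pow_succ]
      ring
    · simp only [Function.update_of_ne hi0])
  intro i hi
  by_cases hi0 : i = i₀
  · subst hi0
    have := key i hi
    rw [Function.update_self] at this
    rw [hp, this, mul_zero]
  · simpa [Function.update_of_ne hi0] using key i hi

open Classical in
theorem NodePolyIndep.of_contract {I : Finset ι} {i₀ : ι} {D : Finset σ} {c : ℕ}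
    (h : NodePolyIndep F (insert i₀ (s \ I)) (Function.update Z i₀ D) (Function.update t i₀ c)
      (Function.update r i₀ (∑ i ∈ I, r i)))
    (hindep : NodePolyIndep F I Z t r) (hadm : IsAdmissible k s Z t r) (hI : I ⊆ s) (hi₀ : i₀ ∈ I)
    (hD : ∀ i ∈ I, D ⊆ Z i) (hc : ∀ i ∈ I, c ≤ t i) (htight : k ≤ ∑ i ∈ I, r i + D.card + c) :
    NodePolyIndep F s Z t r := by
  intro q hq hsum
  set p : (MvPolynomial σ F)[X] :=
    ∑ i ∈ I, q i * (X ^ (t i - c) * genericNodePoly F (Z i \ D)) with hp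
  have hpI : p * (X ^ c * genericNodePoly F D) =
      ∑ i ∈ I, q i * (X ^ t i * genericNodePoly F (Z i)) := by
    rw [hp, Finset.sum_mul]
    refine Finset.sum_congr rfl fun i hi => ?_
    rw [← genericNodePoly_mul_sdiff (hD i hi)]
    conv_rhs => rw [← Nat.sub_add_cancel (hc i hi), pow_add]
    ring
  have hne : ∀ i ∈ s \ I, i ≠ i₀ := fun i hi hi0 => (Finset.mem_sdiff.1 hi).2 (hi0 ▸ hi₀)
  have hnot : i₀ ∉ s \ I := fun hi => hne i₀ hi rfl
  have key := h (Function.update q i₀ p) (fun i hi => by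
    rcases Finset.mem_insert.1 hi with rfl | hi
    · simp only [Function.update_self]
      refine Submodule.sum_mem _ fun l hl => mul_mem_degreeLT_of_monic (hq l (hI hl))
        ((monic_X_pow _).mul (genericNodePoly_monic _)) ?_
      rw [(monic_X_pow _).natDegree_mul (genericNodePoly_monic _), natDegree_X_pow,
        genericNodePoly_natDegree, Finset.card_sdiff_of_subset (hD l hl)]
      have h1 := hadm.size l (hI hl)
      have h2 := hc l hl
      have h3 := Finset.card_le_card (hD l hl)
      omega
    · simpa [Function.update_of_ne (hne i hi)] using hq i (Finset.mem_sdiff.1 hi).1) (by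
    rw [Finset.sum_insert hnot, ← hsum, ← Finset.sum_sdiff hI, add_comm]
    simp only [Function.update_self, hpI]
    congr 1
    refine Finset.sum_congr rfl fun i hi => ?_
    simp only [Function.update_of_ne (hne i hi)])
  have hp0 : p = 0 := by simpa using key i₀ (Finset.mem_insert_self _ _)
  intro i hi
  by_cases hiI : i ∈ I
  · exact hindep q (fun i hi => hq i (hI hi)) (by rw [← hpI, hp0, zero_mul]) i hiI
  · have hiS := Finset.mem_sdiff.2 ⟨hi, hiI⟩
    simpa [Function.update_of_ne (hne i hiS)] using key i (Finset.mem_insert_of_mem hiS)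

theorem IsAdmissible.nodePolyIndep (F : Type*) [Field F] (h : IsAdmissible k s Z t r) :
    NodePolyIndep F s Z t r := by
  classical
  obtain ⟨m, hm⟩ : ∃ m, s.card = m := ⟨_, rfl⟩
  induction m using Nat.strong_induction_on generalizing k s Z t r with
  | _ m ihm =>
  obtain ⟨N, hN⟩ : ∃ N, k + ∑ i ∈ s, (r i + (Z i).card) = N := ⟨_, rfl⟩
  induction N using Nat.strong_induction_on generalizing k s Z t r with
  | _ N ihN =>
  subst hm hN
  rcases s.eq_empty_or_nonempty with rfl | hs
  · intro q _ _ i hi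
    simp at hi
  by_cases hr : ∃ i ∈ s, r i = 0
  · obtain ⟨i₀, hi₀, hr⟩ := hr
    exact .of_erase (ihm _ (Finset.card_erase_lt_of_mem hi₀) (h.mono (Finset.erase_subset _ _)) rfl)
      hi₀ hr
  push Not at hr
  by_cases ht : ∀ i ∈ s, 0 < t i
  · refine .of_tsub_one (ihN _ ?_ (h.tsub_one ht) rfl rfl) ht
    obtain ⟨i, hi⟩ := hs
    have h1 := h.size i hi
    have h2 := ht i hi
    omega
  push Not at ht
  obtain ⟨i₁, hi₁, ht₁⟩ := ht
  have ht₁ : t i₁ = 0 := by omega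
  by_cases huniq : ∀ i ∈ s, i ≠ i₁ → 0 < t i
  · refine .of_update_succ (ihN _ ?_ (h.update_succ (Nat.pos_of_ne_zero (hr i₁ hi₁))) rfl rfl)
      hi₁ ht₁ huniq
    refine Nat.add_lt_add_left (Finset.sum_lt_sum (fun i _ => ?_) ⟨i₁, hi₁, ?_⟩) _
    · by_cases hi : i = i₁
      · subst hi
        simp
      · simp [Function.update_of_ne hi]
    · have := hr i₁ hi₁
      simp only [Function.update_self]
      omega
  push Not at huniq
  obtain ⟨i₂, hi₂, hne, ht₂⟩ := huniq
  have ht₂ : t i₂ = 0 := by omega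
  by_cases htight : ∃ I ⊆ s, 1 < I.card ∧ I.card < s.card ∧ ∃ (D : Finset σ) (c : ℕ),
      (∀ i ∈ I, D ⊆ Z i) ∧ (∀ i ∈ I, c ≤ t i) ∧ k ≤ ∑ i ∈ I, r i + D.card + c
  · obtain ⟨I, hI, h1, h2, D, c, hD, hc, hk⟩ := htight
    obtain ⟨i₀, hi₀⟩ := Finset.card_pos.1 (zero_lt_one.trans h1)
    refine .of_contract (ihm _ ?_ (h.contract hI hi₀ hD hc hk) rfl) (ihm _ h2 (h.mono hI) rfl)
      h hI hi₀ hD hc hk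
    have h3 := Finset.card_insert_le i₀ (s \ I)
    rw [Finset.card_sdiff_of_subset hI] at h3
    omega
  push Not at htight
  obtain ⟨j, hj₁, hj₂⟩ : ∃ j ∈ Z i₁, j ∉ Z i₂ := by
    by_contra! hsub
    have hb := h.bound {i₁, i₂} (by
      intro i hi
      rcases Finset.mem_insert.1 hi with rfl | hi
      · exact hi₁
      · rwa [Finset.mem_singleton.1 hi]) ⟨i₁, by simp⟩ (Z i₁) 0
      (by simpa [Finset.subset_iff] using hsub) (by simp)
    rw [Finset.sum_pair hne.symm] at hb
    have h1 := h.size i₁ hi₁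
    have h2 := hr i₂ hi₂
    omega
  refine .of_merge (j := j) (ihN _ ?_ (h.merge hi₂ ht₂ hj₂ htight) rfl rfl)
  refine Nat.add_lt_add_left (Finset.sum_lt_sum (fun i _ => ?_) ⟨i₁, hi₁, ?_⟩) _
  · have := Finset.card_erase_le (s := Z i) (a := j)
    omega
  · have := Finset.card_erase_lt_of_mem hj₁
    omega

end NodePoly

section Degree

open Polynomial

variable {F : Type*} [Field F] {σ : Type*}

theorem degreeOf_det_le {n : ℕ} (v : σ) (A : Matrix (Fin n) (Fin n) (MvPolynomial σ F))
    (b : Fin n → ℕ) (hA : ∀ i j, (A i j).degreeOf v ≤ b i) :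
    A.det.degreeOf v ≤ ∑ i, b i := by
  rw [← Matrix.det_transpose, Matrix.det_apply]
  refine (MvPolynomial.degreeOf_sum_le v _ _).trans (Finset.sup_le fun τ _ => ?_)
  have hprod : (∏ i, A.transpose (τ i) i).degreeOf v ≤ ∑ i, b i :=
    (MvPolynomial.degreeOf_prod_le v _ _).trans (Finset.sum_le_sum fun i _ => hA i (τ i))
  rcases Int.units_eq_one_or (Equiv.Perm.sign τ) with h | h
  · simpa [h] using hprod
  · simpa [h, MvPolynomial.degreeOf_neg] using hprod

open Classical in
theorem degreeOf_coeff_genericNodePoly_le (v : σ) (Z : Finset σ) (l : ℕ) :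
    ((genericNodePoly F Z).coeff l).degreeOf v ≤ if v ∈ Z then 1 else 0 := by
  induction Z using Finset.induction_on generalizing l with
  | empty =>
    rw [genericNodePoly, Finset.prod_empty, coeff_one]
    split_ifs <;> simp
  | insert j Z hj ih =>
    have hrec : genericNodePoly F (insert j Z) =
        X * genericNodePoly F Z - C (MvPolynomial.X j) * genericNodePoly F Z := by
      rw [genericNodePoly, Finset.prod_insert hj, sub_mul, genericNodePoly]
    rw [hrec, coeff_sub, coeff_C_mul]
    refine (MvPolynomial.degreeOf_sub_le v _ _).trans (max_le ?_ ?_)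
    · have hmono : (if v ∈ Z then 1 else 0) ≤ if v ∈ insert j Z then 1 else 0 := by
        split_ifs <;> simp_all
      cases l with
      | zero => simp
      | succ l =>
        rw [coeff_X_mul]
        exact (ih l).trans hmono
    · refine (MvPolynomial.degreeOf_mul_le v _ _).trans ?_
      have h1 := ih l
      rw [MvPolynomial.degreeOf_X]
      by_cases hv : v = j
      · subst hv
        simp only [hj, if_false] at h1
        simpa using h1
      · simpa [hv] using h1

end Degree

section GeneratorMatrix

open Polynomial

variable {F : Type*} [Field F] {σ : Type*}

/-- The coefficient matrix of the generic node polynomials of the patterns `S i`. -/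
noncomputable def nodeCoeffMatrix (F : Type*) [Field F] {σ : Type*} {m : ℕ}
    (S : Fin m → Finset σ) : Matrix (Fin m) (Fin m) (MvPolynomial σ F) :=
  .of fun i l => (genericNodePoly F (S i)).coeff l

theorem det_nodeCoeffMatrix_ne_zero {m : ℕ} {S : Fin m → Finset σ}
    (h : IsAdmissible m Finset.univ S (fun _ => 0) (fun _ => 1)) :
    (nodeCoeffMatrix F S).det ≠ 0 := by
  intro h0
  obtain ⟨v, hv, hv0⟩ := Matrix.exists_vecMul_eq_zero_iff.2 h0
  refine hv (funext fun i => ?_)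
  have key := h.nodePolyIndep F (fun i => C (v i))
    (fun i _ => by
      rw [mem_degreeLT]
      exact degree_C_le.trans_lt (by simp)) (by
    ext1 l
    simp only [pow_zero, one_mul, finsetSum_coeff, coeff_C_mul, coeff_zero]
    by_cases hl : l < m
    · exact congrFun hv0 ⟨l, hl⟩
    · refine Finset.sum_eq_zero fun i _ => ?_
      rw [coeff_eq_zero_of_natDegree_lt, mul_zero]
      have := h.size i (Finset.mem_univ i)
      rw [genericNodePoly_natDegree]
      omega) i (Finset.mem_univ i)
  simpa using key

theorem sum_eval_coeff_mul_pow {m : ℕ} {Z : Finset σ} (hZ : Z.card < m) (a : σ → F) (x : F) :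
    ∑ l : Fin m, MvPolynomial.eval a ((genericNodePoly F Z).coeff l) * x ^ (l : ℕ) =
      ∏ j ∈ Z, (x - a j) := by
  have h1 : ((genericNodePoly F Z).map (MvPolynomial.eval a)).eval x = ∏ j ∈ Z, (x - a j) := by
    simp [genericNodePoly, Polynomial.map_prod, eval_prod]
  rw [← h1, eval_eq_sum_range' (n := m), ← Fin.sum_univ_eq_sum_range
    (fun l => ((genericNodePoly F Z).map (MvPolynomial.eval a)).coeff l * x ^ l)]
  · simp
  · refine natDegree_map_le.trans_lt ?_
    rwa [genericNodePoly_natDegree]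

/-- Distinct evaluation points together with an invertible coefficient matrix give an MDS matrix. -/
theorem det_submatrix_nodeCoeffMatrix_mul_ne_zero {m n : ℕ} {S : Fin m → Finset σ} {a : σ → F}
    (hdet : MvPolynomial.eval a (nodeCoeffMatrix F S).det ≠ 0) {x : Fin n → F}
    (hx : Function.Injective x) {f : Fin m → Fin n} (hf : Function.Injective f) :
    ((Matrix.of fun i j => ∑ l : Fin m,
      MvPolynomial.eval a ((genericNodePoly F (S i)).coeff l) * x j ^ (l : ℕ)).submatrix id f).det
      ≠ 0 := by
  have : (Matrix.of fun i j => ∑ l : Fin m,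
      MvPolynomial.eval a ((genericNodePoly F (S i)).coeff l) * x j ^ (l : ℕ)).submatrix id f =
      (nodeCoeffMatrix F S).map (MvPolynomial.eval a) *
        (Matrix.vandermonde (x ∘ f)).transpose := by
    ext i j
    simp [Matrix.mul_apply, nodeCoeffMatrix, Matrix.vandermonde]
  rw [this, Matrix.det_mul, Matrix.det_transpose]
  refine mul_ne_zero ?_ (Matrix.det_vandermonde_ne_zero_iff.2 (hx.comp hf))
  rwa [RingHom.map_det] at hdet

end GeneratorMatrix

section ZeroPattern

variable {m n : ℕ} (M : Matrix (Fin m) (Fin n) Bool)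

/-- The zero positions of a row, completed to size `m - 1` by the private nodes `(i, e)`, `e ∈ W i`.
-/
def paddedZeros (W : Fin m → Finset (Fin m)) (i : Fin m) : Finset (Fin n ⊕ Fin m × Fin m) :=
  (rowSupp M i)ᶜ.disjSum ({i} ×ˢ W i)

variable {M}

theorem MDSCondition.card_add_card_le (h : MDSCondition M) (hmn : m ≤ n) {I : Finset (Fin m)}
    (hI : I.Nonempty) {D : Finset (Fin n)} (hD : ∀ i ∈ I, D ⊆ (rowSupp M i)ᶜ) :
    I.card + D.card ≤ m := by
  have h1 := h I hI
  have h2 : D ⊆ (I.biUnion fun i => rowSupp M i)ᶜ := by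
    intro j hj
    simp only [Finset.mem_compl, Finset.mem_biUnion, not_exists, not_and]
    exact fun i hi => Finset.mem_compl.1 (hD i hi hj)
  have h3 := Finset.card_le_card h2
  rw [Finset.card_compl, Fintype.card_fin] at h3
  have h4 := Finset.card_le_univ (I.biUnion fun i => rowSupp M i)
  rw [Fintype.card_fin] at h4
  omega

theorem MDSCondition.isAdmissible_paddedZeros (h : MDSCondition M) (hmn : m ≤ n)
    {W : Fin m → Finset (Fin m)} (hW : ∀ i, (rowSupp M i)ᶜ.card + (W i).card + 1 = m) :
    IsAdmissible m Finset.univ (paddedZeros M W) (fun _ => 0) (fun _ => 1) where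
  size i _ := by
    rw [paddedZeros, Finset.card_disjSum, Finset.card_product, Finset.card_singleton]
    have := hW i
    omega
  bound I _ hI D d hD hd := by
    obtain ⟨i, hi⟩ := hI
    have hd0 := hd i hi
    rw [Finset.sum_const, smul_eq_mul, mul_one]
    have hleft : I.card + D.toLeft.card ≤ m := by
      refine h.card_add_card_le hmn ⟨i, hi⟩ fun l hl j hj => ?_
      have := hD l hl (Finset.mem_toLeft.1 hj)
      simpa [paddedZeros] using this
    by_cases hsingle : ∃ l ∈ I, l ≠ i
    · obtain ⟨l, hl, hli⟩ := hsingle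
      have hright : D.toRight = ∅ := by
        refine Finset.eq_empty_of_forall_notMem fun p hp => hli ?_
        have h1 := hD l hl (Finset.mem_toRight.1 hp)
        have h2 := hD i hi (Finset.mem_toRight.1 hp)
        simp only [paddedZeros, Finset.inr_mem_disjSum, Finset.mem_product,
          Finset.mem_singleton] at h1 h2
        rw [← h1.1, h2.1]
      have := Finset.card_toLeft_add_card_toRight (u := D)
      rw [hright, Finset.card_empty] at this
      omega
    · push Not at hsingle
      obtain rfl : I = {i} := Finset.eq_singleton_iff_unique_mem.2 ⟨hi, hsingle⟩
      have h1 := Finset.card_le_card (hD i hi)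
      rw [paddedZeros, Finset.card_disjSum, Finset.card_product, Finset.card_singleton] at h1
      have h2 := hW i
      rw [Finset.card_singleton]
      omega

theorem MDSCondition.exists_padding (h : MDSCondition M) (hmn : m ≤ n) :
    ∃ W : Fin m → Finset (Fin m), ∀ i, (rowSupp M i)ᶜ.card + (W i).card + 1 = m := by
  refine ⟨fun i => Finset.univ.filter fun e : Fin m => e.1 < m - 1 - (rowSupp M i)ᶜ.card,
    fun i => ?_⟩
  have h1 := h.card_add_card_le hmn (Finset.singleton_nonempty i) (D := (rowSupp M i)ᶜ)
    (fun l hl => by rw [Finset.mem_singleton.1 hl])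
  rw [Finset.card_singleton] at h1
  dsimp only
  rw [Fin.card_filter_val_lt]
  omega

open Classical in
theorem MDSCondition.sum_mem_paddedZeros_lt (h : MDSCondition M) (hmn : m ≤ n) (hm : 1 < m)
    (W : Fin m → Finset (Fin m)) (v : Fin n ⊕ Fin m × Fin m) :
    ∑ i, (if v ∈ paddedZeros M W i then 1 else 0) < m := by
  obtain ⟨i, hi⟩ : ∃ i, v ∉ paddedZeros M W i := by
    by_contra! hall
    rcases v with j | ⟨i, e⟩
    · have := h.card_add_card_le hmn (I := Finset.univ) (D := {j})
        (Finset.univ_nonempty_iff.2 ⟨⟨0, by omega⟩⟩)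
        (fun i _ => by simpa [paddedZeros] using hall i)
      simp at this
    · have h0 := hall ⟨0, by omega⟩
      have h1 := hall ⟨1, hm⟩
      simp only [paddedZeros, Finset.inr_mem_disjSum, Finset.mem_product,
        Finset.mem_singleton] at h0 h1
      have := h0.1.symm.trans h1.1
      simp at this
  calc ∑ i, (if v ∈ paddedZeros M W i then 1 else 0) < ∑ _i : Fin m, 1 :=
        Finset.sum_lt_sum (fun l _ => by split_ifs <;> omega) ⟨i, Finset.mem_univ i, by simp [hi]⟩
    _ = m := by simp

end ZeroPattern

/-- The GM-MDS conjecture for `m ≤ 5`: if the binary `m × n` matrix `M`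
(`1 < m ≤ 5`, `m ≤ n`) satisfies the MDS condition, then over any finite field
`F` with `|F| ≥ n + m - 1` there is a matrix `G` fitting `M` (zeros of `M`
force zeros of `G`) all of whose `m × m` submatrices are nonsingular, i.e. `G`
is a generator matrix of an `[n, m]` MDS code over `F`. -/
theorem gm_mds_five {m n : ℕ} (hm : 1 < m) (hm5 : m ≤ 5) (hmn : m ≤ n)
    (F : Type*) [Field F] [Fintype F] (hF : n + m - 1 ≤ Fintype.card F)
    (M : Matrix (Fin m) (Fin n) Bool) (hMDS : MDSCondition M) :
    ∃ G : Matrix (Fin m) (Fin n) F,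
      (∀ i j, M i j = false → G i j = 0) ∧
      ∀ f : Fin m → Fin n, Function.Injective f →
        (G.submatrix id f).det ≠ 0 := by
  classical
  obtain ⟨W, hW⟩ := hMDS.exists_padding hmn
  have hadm := hMDS.isAdmissible_paddedZeros hmn hW
  set S := paddedZeros M W with hS
  let V : Matrix (Fin n) (Fin n) (MvPolynomial (Fin n ⊕ Fin m × Fin m) F) :=
    Matrix.vandermonde fun j => MvPolynomial.X (Sum.inl j)
  have hV : V.det ≠ 0 := Matrix.det_vandermonde_ne_zero_iff.2
    ((MvPolynomial.X_injective).comp Sum.inl_injective)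
  have hdegV : ∀ v, V.det.degreeOf v ≤ n - 1 := by
    intro v
    refine (degreeOf_det_le v V (fun j => if v = Sum.inl j then n - 1 else 0) fun j l => ?_).trans ?_
    · refine (MvPolynomial.degreeOf_pow_le _ _ _).trans ?_
      rw [MvPolynomial.degreeOf_X]
      have := l.2
      split_ifs
      · omega
      · simp
    · rcases v with j | e
      · simp
      · simp
  have hne : (nodeCoeffMatrix F S).det * V.det ≠ 0 :=
    mul_ne_zero (det_nodeCoeffMatrix_ne_zero hadm) hV
  obtain ⟨a, ha⟩ : ∃ a, MvPolynomial.eval a ((nodeCoeffMatrix F S).det * V.det) ≠ 0 := by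
    by_contra! hall
    refine hne (MvPolynomial.eq_zero_of_eval_zero_at_prod_finset _ (fun _ => Finset.univ)
      (fun v => ?_) fun x _ => hall x)
    refine (MvPolynomial.degreeOf_mul_le v _ _).trans_lt ?_
    have h1 : (nodeCoeffMatrix F S).det.degreeOf v < m := by
      refine (degreeOf_det_le v (nodeCoeffMatrix F S) _ fun i l =>
        degreeOf_coeff_genericNodePoly_le v (S i) l).trans_lt ?_
      refine lt_of_eq_of_lt (Finset.sum_congr rfl fun i _ => ?_)
        (hMDS.sum_mem_paddedZeros_lt hmn hm W v)
      congr
    have h3 := hdegV v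
    rw [Finset.card_univ]
    omega
  rw [map_mul] at ha
  have hinj : Function.Injective fun j : Fin n => a (Sum.inl j) := by
    have h1 := right_ne_zero_of_mul ha
    rw [RingHom.map_det] at h1
    refine Matrix.det_vandermonde_ne_zero_iff.1 ?_
    convert h1 using 2
    ext i j
    simp [V, Matrix.vandermonde]
  refine ⟨_, fun i j hij => ?_, fun f hf =>
    det_submatrix_nodeCoeffMatrix_mul_ne_zero (left_ne_zero_of_mul ha) hinj hf⟩
  rw [Matrix.of_apply, sum_eval_coeff_mul_pow]
  · exact Finset.prod_eq_zero (i := Sum.inl j) (by simp [hS, paddedZeros, rowSupp, hij]) (sub_self _)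
  · have := hadm.size i (Finset.mem_univ i)
    omega
end

section
/- Let {P_1,…,P_m} be polynomials with root-sets N_i ⊆ N of sizes 0 ≤ d_i ≤ m−1, let R ⊆ N be any reduction set with reduced polynomials P̃_i(α) = ∏_{γ ∈ N_i∖R}(α − γ), and for each α_r ∈ R let n_r = |{i ∈ [m] : α_r ∈ N_i}|. Then, viewing W(P_1,…,P_m) as a polynomial in the variables α_r for α_r ∈ R (with coefficients polynomials in the remaining variables), the degree of W(P_1,…,P_m) in each variable α_r is at most n_r, and the coefficient of the monomial ∏_{α_r ∈ R} α_r^{n_r} in W(P_1,…,P_m) equals (−1)^{Σ_{α_r ∈ R} n_r} · W(P̃_1,…,P̃_m). -/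
open Polynomial

theorem Polynomial.natDegree_prod_le_and_coeff_prod {S ι : Type*} [CommRing S] (s : Finset ι)
    (f : ι → S[X]) (k : ι → ℕ) (h : ∀ i ∈ s, (f i).natDegree ≤ k i) :
    (∏ i ∈ s, f i).natDegree ≤ ∑ i ∈ s, k i ∧
      (∏ i ∈ s, f i).coeff (∑ i ∈ s, k i) = ∏ i ∈ s, (f i).coeff (k i) := by
  classical
  induction s using Finset.induction_on with
  | empty => simp
  | insert a s ha ih =>
    obtain ⟨ih₁, ih₂⟩ := ih fun i hi => h i (Finset.mem_insert_of_mem hi)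
    have h₀ := h a (Finset.mem_insert_self a s)
    rw [Finset.prod_insert ha, Finset.sum_insert ha, Finset.prod_insert ha]
    exact ⟨natDegree_mul_le_of_le h₀ ih₁, by rw [coeff_mul_add_eq_of_natDegree_le h₀ ih₁, ih₂]⟩

/-- If the entries in column `j` have degree at most `k j`, the determinant has degree at most
`∑ j, k j`, and its coefficient there is the determinant of the top coefficients. -/
theorem Matrix.natDegree_det_le_and_coeff_det {S ι : Type*} [CommRing S] [Fintype ι]
    [DecidableEq ι] (A : Matrix ι ι S[X]) (k : ι → ℕ) (h : ∀ i j, (A i j).natDegree ≤ k j) :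
    A.det.natDegree ≤ ∑ j, k j ∧
      A.det.coeff (∑ j, k j) = (Matrix.of fun i j => (A i j).coeff (k j)).det := by
  have key (σ : Equiv.Perm ι) := Polynomial.natDegree_prod_le_and_coeff_prod Finset.univ
    (fun j => A (σ j) j) k fun j _ => h (σ j) j
  rw [Matrix.det_apply, Matrix.det_apply]
  constructor
  · exact natDegree_sum_le_of_forall_le _ _ fun σ _ =>
      (natDegree_smul_le _ _).trans (key σ).1
  · rw [finsetSum_coeff]
    refine Finset.sum_congr rfl fun σ _ => ?_
    rw [coeff_smul, (key σ).2]
    rfl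

/-- View a multivariate polynomial as a univariate polynomial in the variable `r`. -/
noncomputable def MvPolynomial.toUnivariate (F : Type*) [CommRing F] {σ : Type*} [DecidableEq σ]
    (r : σ) : MvPolynomial σ F →ₐ[F] (MvPolynomial σ F)[X] :=
  MvPolynomial.aeval fun s => if s = r then Polynomial.X else Polynomial.C (MvPolynomial.X s)

namespace MvPolynomial

variable {F : Type*} [CommRing F] {σ : Type*} [DecidableEq σ] (r : σ)

theorem toUnivariate_monomial (e : σ →₀ ℕ) (a : F) :
    toUnivariate F r (monomial e a) =
      Polynomial.C (monomial (e.erase r) a) * Polynomial.X ^ e r := by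
  have h : e.prod (fun s t => (if s = r then Polynomial.X
      else Polynomial.C (X s : MvPolynomial σ F)) ^ t) =
      Polynomial.X ^ e r * Polynomial.C ((e.erase r).prod fun s t => (X s) ^ t) := by
    rw [← Finsupp.mul_prod_erase' e r _ (by simp), if_pos rfl]
    congr 1
    rw [Finsupp.prod, Finsupp.prod, map_prod]
    refine Finset.prod_congr rfl fun s hs => ?_
    have : s ≠ r := by rintro rfl; simp at hs
    simp [this]
  rw [toUnivariate, aeval_monomial, h, monomial_eq, map_mul, Polynomial.algebraMap_apply,
    algebraMap_eq]
  ring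

theorem coeff_coeff_toUnivariate (p : MvPolynomial σ F) (k : ℕ) (d : σ →₀ ℕ) (hd : d r = 0) :
    coeff d ((toUnivariate F r p).coeff k) = coeff (d + Finsupp.single r k) p := by
  induction p using MvPolynomial.induction_on' with
  | monomial e a =>
    rw [toUnivariate_monomial, Polynomial.coeff_C_mul, Polynomial.coeff_X_pow, coeff_monomial]
    have h : e = d + Finsupp.single r k ↔ k = e r ∧ e.erase r = d := by
      constructor
      · rintro rfl
        simp [hd, Finsupp.erase_add, Finsupp.erase_of_notMem_support]
      · rintro ⟨rfl, rfl⟩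
        exact (Finsupp.erase_add_single r e).symm
    simp only [h]
    by_cases hk : k = e r <;> simp [hk, coeff_monomial]
  | add p q hp hq => simp [hp, hq]

theorem degreeOf_le_of_natDegree_toUnivariate_le {p : MvPolynomial σ F} {k : ℕ}
    (h : (toUnivariate F r p).natDegree ≤ k) : degreeOf r p ≤ k := by
  rw [degreeOf_le_iff]
  intro e he
  by_contra! hk
  have := coeff_coeff_toUnivariate r p (e r) (e.erase r) (by simp)
  rw [Polynomial.coeff_eq_zero_of_natDegree_lt (h.trans_lt hk), Finsupp.erase_add_single] at this
  exact mem_support_iff.1 he (by simpa using this.symm)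

end MvPolynomial

open MvPolynomial in
theorem toUnivariate_coeff_rootPoly {F : Type*} [Field F] {n : ℕ} {r : Fin n}
    {s : Finset (Fin n)} (hr : r ∉ s) (k i : ℕ) :
    toUnivariate F r ((Polynomial.X ^ k * rootPoly F s).coeff i) =
      Polynomial.C ((Polynomial.X ^ k * rootPoly F s).coeff i) := by
  have h : (Polynomial.X ^ k * rootPoly F s).map (toUnivariate F r : _ →+* _) =
      (Polynomial.X ^ k * rootPoly F s).map Polynomial.C := by
    simp only [rootPoly, Polynomial.map_mul, Polynomial.map_pow, Polynomial.map_X,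
      Polynomial.map_prod, Polynomial.map_sub, Polynomial.map_C]
    congr 1
    refine Finset.prod_congr rfl fun γ hγ => ?_
    have : γ ≠ r := by rintro rfl; exact hr hγ
    simp [toUnivariate, this]
  exact (Polynomial.coeff_map _ i).symm.trans <|
    (congrArg (Polynomial.coeff · i) h).trans (Polynomial.coeff_map _ i)

open MvPolynomial in
theorem natDegree_le_and_coeff_toUnivariate_coeff_rootPoly {F : Type*} [Field F] {n : ℕ}
    (r : Fin n) (s : Finset (Fin n)) (i : ℕ) :
    (toUnivariate F r ((rootPoly F s).coeff i)).natDegree ≤ (if r ∈ s then 1 else 0) ∧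
      (toUnivariate F r ((rootPoly F s).coeff i)).coeff (if r ∈ s then 1 else 0) =
        (-1) ^ (if r ∈ s then 1 else 0) * (rootPoly F (s \ {r})).coeff i := by
  by_cases hr : r ∈ s
  · have hs : rootPoly F s = (Polynomial.X - Polynomial.C (X r)) * rootPoly F (s \ {r}) := by
      rw [rootPoly, rootPoly, Finset.sdiff_singleton_eq_erase,
        Finset.mul_prod_erase s (fun γ => Polynomial.X - Polynomial.C (X γ)) hr]
    have hn : r ∉ s \ {r} := by simp
    have h₀ := toUnivariate_coeff_rootPoly (F := F) hn 0 i
    have h₁ := toUnivariate_coeff_rootPoly (F := F) hn 1 i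
    rw [pow_zero, one_mul] at h₀
    rw [pow_one] at h₁
    have hX : toUnivariate F r (X r) = Polynomial.X := by simp [toUnivariate]
    rw [hs, sub_mul, Polynomial.coeff_sub, Polynomial.coeff_C_mul, map_sub, map_mul, h₀, h₁, hX]
    simp only [hr, if_true]
    constructor
    · compute_degree
    · simp [Polynomial.coeff_C]
  · have h₀ := toUnivariate_coeff_rootPoly (F := F) hr 0 i
    rw [pow_zero, one_mul] at h₀
    simp [hr, h₀, Finset.sdiff_singleton_eq_erase]

open MvPolynomial in
theorem toUnivariate_Wdet (F : Type*) [Field F] {n m : ℕ} (N : Fin m → Finset (Fin n))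
    (r : Fin n) :
    (toUnivariate F r (Wdet F N)).natDegree ≤ (Finset.univ.filter fun i => r ∈ N i).card ∧
      (toUnivariate F r (Wdet F N)).coeff (Finset.univ.filter fun i => r ∈ N i).card =
        (-1) ^ (Finset.univ.filter fun i => r ∈ N i).card * Wdet F fun i => N i \ {r} := by
  have key (i j : Fin m) := natDegree_le_and_coeff_toUnivariate_coeff_rootPoly (F := F) r (N j) i
  rw [Finset.card_filter]
  obtain ⟨h₁, h₂⟩ := Matrix.natDegree_det_le_and_coeff_det
    (Matrix.of fun i j : Fin m => toUnivariate F r ((rootPoly F (N j)).coeff i))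
    (fun j => if r ∈ N j then 1 else 0) fun i j => (key i j).1
  have hW : toUnivariate F r (Wdet F N) =
      (Matrix.of fun i j : Fin m => toUnivariate F r ((rootPoly F (N j)).coeff i)).det := by
    rw [Wdet, AlgHom.map_det]
    rfl
  rw [hW]
  refine ⟨h₁, h₂.trans ?_⟩
  rw [← Finset.prod_pow_eq_pow_sum, Wdet, ← Matrix.det_mul_row]
  congr 1
  refine Matrix.ext fun i j => ?_
  exact (key i j).2

open MvPolynomial in
theorem coeff_Wdet_add_sum_single (F : Type*) [Field F] {n m : ℕ} (R : Finset (Fin n))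
    (N : Fin m → Finset (Fin n)) (d : Fin n →₀ ℕ) (hd : ∀ r ∈ R, d r = 0) :
    coeff (d + ∑ r ∈ R, Finsupp.single r (Finset.univ.filter fun i => r ∈ N i).card) (Wdet F N) =
      (-1) ^ (∑ r ∈ R, (Finset.univ.filter fun i => r ∈ N i).card) *
        coeff d (Wdet F fun i => N i \ R) := by
  induction R using Finset.induction_on generalizing N with
  | empty => simp
  | insert a R ha ih =>
    have hc : ∀ r ∈ R, (Finset.univ.filter fun i => r ∈ N i).card =
        (Finset.univ.filter fun i => r ∈ N i \ {a}).card := by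
      intro r hr
      have : r ≠ a := by rintro rfl; exact ha hr
      simp [this]
    have hsum : (∑ r ∈ R, Finsupp.single r (Finset.univ.filter fun i => r ∈ N i).card) a = 0 := by
      rw [Finsupp.finsetSum_apply]
      refine Finset.sum_eq_zero fun r hr => Finsupp.single_eq_of_ne ?_
      rintro rfl
      exact ha hr
    have hneg (k : ℕ) (p : MvPolynomial (Fin n) F) (e : Fin n →₀ ℕ) :
        coeff e ((-1) ^ k * p) = (-1) ^ k * coeff e p := by
      rw [← MvPolynomial.coeff_C_mul]
      simp
    rw [Finset.sum_insert ha, Finset.sum_insert ha, add_left_comm, add_comm (Finsupp.single a _),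
      ← coeff_coeff_toUnivariate a _ _ _
        (by rw [Finsupp.add_apply, hd a (Finset.mem_insert_self a R), hsum]),
      (toUnivariate_Wdet F N a).2, hneg, pow_add, mul_assoc]
    congr 1
    have hS : ∀ i, N i \ insert a R = (N i \ {a}) \ R := fun i => by
      rw [sdiff_sdiff_left, Finset.insert_eq, Finset.sup_eq_union]
    simp only [hS]
    rw [← Finset.sum_congr rfl fun r hr => congrArg (Finsupp.single r) (hc r hr).symm,
      Finset.sum_congr rfl hc]
    exact ih (fun i => N i \ {a}) fun r hr => hd r (Finset.mem_insert_of_mem hr)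

/-- For any reduction set `R`, writing `n_r` for the number of polynomials having
`α_r` as a root: the degree of `W(P_1, …, P_m)` in each variable `α_r`, `r ∈ R`,
is at most `n_r`, and the coefficient of the monomial `∏_{α_r ∈ R} α_r^{n_r}`
(viewing `W` as a polynomial in the variables from `R` with coefficients that are
polynomials in the remaining variables) equals
`(-1)^{Σ_{r ∈ R} n_r} ⬝ W(P̃_1, …, P̃_m)`, where `P̃_i` has root-set `N_i ∖ R`.
The coefficient statement is expressed coefficientwise: for every exponent
vector `d` supported away from `R`. -/
theorem Wdet_degree_and_top_coeff (F : Type*) [Field F] {n m : ℕ}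
    (N : Fin m → Finset (Fin n))
    (hdeg : ∀ i, (N i).card ≤ m - 1)
    (R : Finset (Fin n))
    (nr : Fin n → ℕ)
    (hnr : ∀ r, nr r = (Finset.univ.filter (fun i : Fin m => r ∈ N i)).card) :
    (∀ r ∈ R, MvPolynomial.degreeOf r (Wdet F N) ≤ nr r) ∧
    (∀ d : Fin n →₀ ℕ, (∀ r ∈ R, d r = 0) →
      MvPolynomial.coeff (d + ∑ r ∈ R, Finsupp.single r (nr r)) (Wdet F N)
        = (-1) ^ (∑ r ∈ R, nr r)
            * MvPolynomial.coeff d (Wdet F (fun i => N i \ R))) := by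
  obtain rfl : nr = fun r => (Finset.univ.filter fun i : Fin m => r ∈ N i).card := funext hnr
  exact ⟨fun r _ => MvPolynomial.degreeOf_le_of_natDegree_toUnivariate_le r
    (toUnivariate_Wdet F N r).1, coeff_Wdet_add_sum_single F R N⟩
end
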